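/- arXiv:2511.01765 — 2 statements merged into one kernel-verified Lean document; each statement's English description precedes it below -/
import Mathlib

section
/- Let n ≥ 2 and U ⊂ ℝ^n be open. Every f ∈ L¹(U) defines an element of the negative Sobolev–Lorentz space W^{−1,(n/(n−1),∞)}(U), and ‖f‖_{W^{−1,(n/(n−1),∞)}(U)} ≤ C(n) ‖f‖_{L¹(U)}. -/
open MeasureTheory ENNReal

noncomputable section

abbrev Rn (n : ℕ) := Fin n → ℝ

/-- The `j`-th partial derivative of a function on `ℝⁿ`. -/
def pd {n : ℕ} (j : Fin n) (φ : Rn n → ℝ) (x : Rn n) : ℝ :=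
  fderiv ℝ φ x (Pi.single j 1)

open scoped ContDiff in
/-- A test function on the open set `U`: smooth with compact support contained in `U`. -/
def IsTest {n : ℕ} (U : Set (Rn n)) (φ : Rn n → ℝ) : Prop :=
  ContDiff ℝ ∞ φ ∧ HasCompactSupport φ ∧ tsupport φ ⊆ U

/-- The distribution function `d_f(s) = μ{ |f| > s }`. -/
def distFn {α : Type*} [MeasurableSpace α] (μ : Measure α) (f : α → ℝ) (s : ℝ≥0∞) : ℝ≥0∞ :=
  μ {x | s < (‖f x‖₊ : ℝ≥0∞)}

/-- The decreasing rearrangement `f*(t) = inf{ s : d_f(s) ≤ t }`. -/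
def rearr {α : Type*} [MeasurableSpace α] (μ : Measure α) (f : α → ℝ) (t : ℝ≥0∞) : ℝ≥0∞ :=
  sInf {s : ℝ≥0∞ | distFn μ f s ≤ t}

/-- The Lorentz quasinorm `|f|_{L^{p,q}(μ)}`. -/
def lorentzNorm {α : Type*} [MeasurableSpace α] (p : ℝ) (q : ℝ≥0∞) (μ : Measure α)
    (f : α → ℝ) : ℝ≥0∞ :=
  if q = ⊤ then
    ⨆ t : {t : ℝ // 0 < t},
      ENNReal.ofReal ((t : ℝ) ^ (1 / p)) * rearr μ f (ENNReal.ofReal (t : ℝ))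
  else
    (∫⁻ t in Set.Ioi (0 : ℝ),
        (ENNReal.ofReal (t ^ (1 / p)) * rearr μ f (ENNReal.ofReal t)) ^ q.toReal
          / ENNReal.ofReal t) ^ (1 / q.toReal)

section RadialKernel

variable {E : Type*} [NormedAddCommGroup E] [NormedSpace ℝ E]

/-- The radial kernel `‖z‖ ^ (1 - d)` on a normed space of dimension `d`. -/
def radialKernel (z : E) : ℝ := ‖z‖ * (‖z‖ ^ Module.finrank ℝ E)⁻¹

lemma radialKernel_nonneg (z : E) : 0 ≤ radialKernel z := by
  unfold radialKernel; positivity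

lemma radialKernel_le [Nontrivial E] [FiniteDimensional ℝ E] {r : ℝ} (hr : 0 < r) {z : E}
    (hz : r ≤ ‖z‖) : radialKernel z ≤ (r ^ (Module.finrank ℝ E - 1))⁻¹ := by
  have hd : 0 < Module.finrank ℝ E := Module.finrank_pos
  have hz0 : 0 < ‖z‖ := hr.trans_le hz
  have : radialKernel z = (‖z‖ ^ (Module.finrank ℝ E - 1))⁻¹ := by
    unfold radialKernel
    obtain ⟨m, hm⟩ := Nat.exists_eq_succ_of_ne_zero hd.ne'
    rw [hm, Nat.succ_sub_one, Nat.succ_eq_add_one, pow_succ]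
    field_simp
  rw [this]
  gcongr

lemma indicator_ball_radialKernel (r : ℝ) :
    (Metric.ball (0 : E) r).indicator radialKernel =
      fun z : E ↦ (Set.Iio r).indicator
        (fun t : ℝ ↦ t * (t ^ Module.finrank ℝ E)⁻¹) ‖z‖ := by
  ext z
  simp [Set.indicator, radialKernel]

lemma radialKernel_mul_le [Nontrivial E] [FiniteDimensional ℝ E] {M : ℝ} (z : E) {a : ℝ}
    (h : |a| ≤ M) :
    radialKernel z * |a| ≤ M * (Metric.ball (0 : E) 1).indicator radialKernel z + |a| := by
  by_cases hz : z ∈ Metric.ball (0 : E) 1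
  · rw [Set.indicator_of_mem hz, mul_comm M]
    nlinarith [radialKernel_nonneg z, abs_nonneg a]
  · rw [Set.indicator_of_notMem hz]
    have := radialKernel_le (z := z) one_pos (by simpa using hz)
    simp only [one_pow, inv_one] at this
    nlinarith [abs_nonneg a]

variable [MeasurableSpace E] [BorelSpace E]

@[fun_prop]
lemma measurable_radialKernel : Measurable (radialKernel : E → ℝ) := by
  unfold radialKernel
  fun_prop

variable [Nontrivial E] [FiniteDimensional ℝ E] (μ : Measure E) [μ.IsAddHaarMeasure]

lemma pow_smul_indicator_eqOn (d : ℕ) (hd : 0 < d) (r : ℝ) :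
    Set.EqOn (fun y : ℝ ↦ y ^ (d - 1) • (Set.Iio r).indicator (fun t ↦ t * (t ^ d)⁻¹) y)
      ((Set.Iio r).indicator 1) (Set.Ioi 0) := by
  intro y (hy : 0 < y)
  obtain ⟨m, rfl⟩ := Nat.exists_eq_succ_of_ne_zero hd.ne'
  by_cases h : y < r
  · simp only [Nat.succ_eq_add_one, Nat.add_sub_cancel, Set.mem_Iio, h, Set.indicator_of_mem,
      smul_eq_mul, Pi.one_apply, pow_succ]
    field_simp
  · simp [h]

lemma toSphere_real_univ_pos : 0 < μ.toSphere.real Set.univ :=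
  ENNReal.toReal_pos (Measure.measure_univ_ne_zero.2 μ.toSphere_ne_zero) (measure_ne_top _ _)

lemma integrableOn_ball_radialKernel (r : ℝ) :
    IntegrableOn (radialKernel : E → ℝ) (Metric.ball 0 r) μ := by
  rw [← integrable_indicator_iff measurableSet_ball, indicator_ball_radialKernel,
    integrable_fun_norm_addHaar μ,
    integrableOn_congr_fun (pow_smul_indicator_eqOn _ Module.finrank_pos r) measurableSet_Ioi,
    IntegrableOn, integrable_indicator_iff measurableSet_Iio, IntegrableOn,
    Measure.restrict_restrict measurableSet_Iio, Set.Iio_inter_Ioi]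
  exact integrableOn_const (by simp)

lemma setIntegral_ball_radialKernel {r : ℝ} (hr : 0 ≤ r) :
    ∫ z in Metric.ball 0 r, radialKernel (z : E) ∂μ = μ.toSphere.real Set.univ * r := by
  rw [← integral_indicator measurableSet_ball, indicator_ball_radialKernel,
    integral_fun_norm_addHaar μ,
    setIntegral_congr_fun measurableSet_Ioi (pow_smul_indicator_eqOn _ Module.finrank_pos r),
    integral_indicator measurableSet_Iio, Measure.restrict_restrict measurableSet_Iio,
    Set.Iio_inter_Ioi, Measure.toSphere_real_apply_univ]
  simp [hr, mul_assoc]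

lemma integrable_radialKernel_mul {h : E → ℝ} {M : ℝ} (hi : Integrable h μ)
    (hM : ∀ x, |h x| ≤ M) : Integrable (fun z ↦ radialKernel z * h z) μ := by
  refine Integrable.mono' (g := fun z ↦
    M * (Metric.ball (0 : E) 1).indicator radialKernel z + |h z|) ?_
    (measurable_radialKernel.aestronglyMeasurable.mul hi.1) (.of_forall fun z ↦ ?_)
  · exact (((integrable_indicator_iff measurableSet_ball).2
      (integrableOn_ball_radialKernel μ 1)).const_mul M).add hi.abs
  · rw [norm_mul, Real.norm_of_nonneg (radialKernel_nonneg z)]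
    exact radialKernel_mul_le z (hM z)

lemma integral_radialKernel_mul_abs_le {h : E → ℝ} {M : ℝ} (hi : Integrable h μ)
    (hM : ∀ x, |h x| ≤ M) :
    ∫ z, radialKernel z * |h z| ∂μ ≤ M * μ.toSphere.real Set.univ + ∫ z, |h z| ∂μ := by
  have hb := (integrable_indicator_iff measurableSet_ball).2
      (integrableOn_ball_radialKernel μ 1)
  calc ∫ z, radialKernel z * |h z| ∂μ
      ≤ ∫ z, M * (Metric.ball (0 : E) 1).indicator radialKernel z + |h z| ∂μ :=
        integral_mono (integrable_radialKernel_mul μ hi.abs (by simpa using hM))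
          ((hb.const_mul M).add hi.abs) fun z ↦ radialKernel_mul_le z (hM z)
    _ = _ := by
      rw [integral_add (hb.const_mul M) hi.abs, integral_const_mul,
        integral_indicator measurableSet_ball, setIntegral_ball_radialKernel μ zero_le_one,
        mul_one]

/-- The fundamental solution property: `z / ‖z‖ ^ d` has divergence a multiple of the Dirac mass. -/
lemma integral_fderiv_apply_mul_radial {φ : E → ℝ} (hφ : ContDiff ℝ 1 φ)
    (hc : HasCompactSupport φ) (y : E) :
    ∫ z, fderiv ℝ φ (y + z) z * (‖z‖ ^ Module.finrank ℝ E)⁻¹ ∂μ =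
      -(μ.toSphere.real Set.univ * φ y) := by
  set d := Module.finrank ℝ E with hd
  have hdpos : 0 < d := Module.finrank_pos
  set Φ : E → ℝ := fun z ↦ fderiv ℝ φ (y + z) z * (‖z‖ ^ d)⁻¹ with hΦ
  have hcont : Continuous (fderiv ℝ φ) := hφ.continuous_fderiv one_ne_zero
  have hmeas : Measurable Φ := by
    have : Continuous fun z ↦ fderiv ℝ φ (y + z) z := by fun_prop
    exact this.measurable.mul (by fun_prop)
  have hnorm : Integrable (fun z ↦ ‖fderiv ℝ φ (y + z)‖) μ :=
    ((hcont.integrable_of_hasCompactSupport (hc.fderiv (𝕜 := ℝ))).comp_add_left y).norm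
  obtain ⟨M, hM⟩ := hcont.bounded_above_of_compact_support (hc.fderiv (𝕜 := ℝ))
  have hint : Integrable Φ μ := by
    refine (integrable_radialKernel_mul μ (M := M) hnorm (by simpa using fun x ↦ hM (y + x))).mono'
      hmeas.aestronglyMeasurable (.of_forall fun z ↦ ?_)
    rw [hΦ, norm_mul, norm_inv, norm_pow, norm_norm, radialKernel, mul_right_comm, mul_comm ‖z‖]
    gcongr
    exact ContinuousLinearMap.le_opNorm _ _
  set Ψ : Metric.sphere (0 : E) 1 × Set.Ioi (0 : ℝ) → ℝ := fun w ↦ Φ (w.2.1 • w.1.1) with hΨ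
  have hcomp : ∀ x : ({0}ᶜ : Set E), Ψ (homeomorphUnitSphereProd E x) = Φ x := by
    intro x
    have hx : (x : E) ≠ 0 := x.2
    simp [hΨ, smul_smul, hx]
  have hmp := μ.measurePreserving_homeomorphUnitSphereProd
  have hemb := (homeomorphUnitSphereProd E).measurableEmbedding
  have hintΨ : Integrable Ψ (μ.toSphere.prod (.volumeIoiPow (d - 1))) := by
    rw [← hmp.integrable_comp_emb hemb]
    have : Ψ ∘ homeomorphUnitSphereProd E = Φ ∘ Subtype.val := funext hcomp
    rw [this, ← integrableOn_iff_comap_subtypeVal (measurableSet_singleton _).compl]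
    exact hint.integrableOn
  calc ∫ z, Φ z ∂μ = ∫ x : ({0}ᶜ : Set E), Φ x ∂(μ.comap (↑)) := by
        rw [integral_subtype_comap (measurableSet_singleton _).compl Φ, restrict_compl_singleton]
    _ = ∫ w, Ψ w ∂μ.toSphere.prod (.volumeIoiPow (d - 1)) := by
        rw [← hmp.integral_comp hemb]
        simp_rw [hcomp]
    _ = ∫ ω, ∫ r, Ψ (ω, r) ∂.volumeIoiPow (d - 1) ∂μ.toSphere := integral_prod _ hintΨ
    _ = ∫ ω, -φ y ∂μ.toSphere := by
        congr 1 with ω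
        have hω : ‖(ω : E)‖ = 1 := by simp
        have hω0 : (ω : E) ≠ 0 := by rw [← norm_ne_zero_iff, hω]; exact one_ne_zero
        have hψ : ContDiff ℝ 1 fun r : ℝ ↦ φ (y + r • (ω : E)) := by fun_prop
        have hψc : HasCompactSupport fun r : ℝ ↦ φ (y + r • (ω : E)) :=
          hc.comp_isClosedEmbedding
            ((Homeomorph.addLeft y).isClosedEmbedding.comp (isClosedEmbedding_smul_left hω0))
        have key := hψc.integral_Ioi_deriv_eq hψ 0
        simp only [zero_smul, add_zero] at key
        rw [← key]
        simp only [Measure.volumeIoiPow, ENNReal.ofReal]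
        rw [integral_withDensity_eq_integral_smul
            (by exact (measurable_subtype_coe.pow_const _).real_toNNReal),
          integral_subtype_comap measurableSet_Ioi
            fun a ↦ Real.toNNReal (a ^ (d - 1)) • Φ (a • (ω : E))]
        refine setIntegral_congr_fun measurableSet_Ioi fun r (hr : 0 < r) ↦ ?_
        have hder : HasDerivAt (fun r : ℝ ↦ φ (y + r • (ω : E)))
            (fderiv ℝ φ (y + r • (ω : E)) ω) r := by
          have h1 : HasDerivAt (fun r : ℝ ↦ y + r • (ω : E)) (ω : E) r := by
            simpa using ((hasDerivAt_id r).smul_const (ω : E)).const_add y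
          exact ((hφ.differentiable one_ne_zero _).hasFDerivAt).comp_hasDerivAt r h1
        rw [hder.deriv, NNReal.smul_def, Real.coe_toNNReal _ (by positivity), hΦ]
        simp only [norm_smul, hω, map_smul, smul_eq_mul, mul_one, Real.norm_of_nonneg hr.le]
        obtain ⟨m, hm⟩ := Nat.exists_eq_succ_of_ne_zero hdpos.ne'
        rw [hm, Nat.succ_sub_one, Nat.succ_eq_add_one, pow_succ]
        field_simp
    _ = _ := by simp

end RadialKernel

section WeakType

variable {E : Type*} [NormedAddCommGroup E] [NormedSpace ℝ E] [MeasurableSpace E]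
  [Nontrivial E] [FiniteDimensional ℝ E] {ν : Measure E} {g K : E → ℝ}

lemma enorm_integral_kernel_le (hg : Integrable g ν) (hKle : ∀ z, |K z| ≤ radialKernel z)
    {r : ℝ} (hr : 0 < r) (x : E) :
    ‖∫ y, g y * K (x - y) ∂ν‖ₑ ≤
      ∫⁻ y, ‖g y‖ₑ * ENNReal.ofReal ((Metric.ball (0 : E) r).indicator radialKernel (x - y)) ∂ν +
      ENNReal.ofReal ((r ^ (Module.finrank ℝ E - 1))⁻¹ * ∫ y, |g y| ∂ν) := by
  set R := (r ^ (Module.finrank ℝ E - 1))⁻¹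
  have hR : 0 ≤ R := by positivity
  calc ‖∫ y, g y * K (x - y) ∂ν‖ₑ
      ≤ ∫⁻ y, ‖g y * K (x - y)‖ₑ ∂ν := enorm_integral_le_lintegral_enorm _
    _ ≤ ∫⁻ y, (‖g y‖ₑ * ENNReal.ofReal ((Metric.ball (0 : E) r).indicator radialKernel (x - y)) +
          ‖g y‖ₑ * ENNReal.ofReal R) ∂ν := by
        refine lintegral_mono fun y ↦ ?_
        rw [enorm_mul, ← mul_add]
        gcongr
        rw [Real.enorm_eq_ofReal_abs,
          ← ENNReal.ofReal_add (Set.indicator_nonneg (fun z _ ↦ radialKernel_nonneg z) _) hR]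
        refine ENNReal.ofReal_le_ofReal ((hKle _).trans ?_)
        by_cases hz : x - y ∈ Metric.ball (0 : E) r
        · rw [Set.indicator_of_mem hz]
          linarith
        · rw [Set.indicator_of_notMem hz, zero_add]
          exact radialKernel_le hr (by simpa using hz)
    _ = _ := by
        rw [lintegral_add_right' _ (by fun_prop (disch := exact hg.1.aemeasurable)),
          lintegral_mul_const'' _ hg.1.aemeasurable.enorm,
          ← ofReal_integral_norm_eq_lintegral_enorm hg, mul_comm R,
          ENNReal.ofReal_mul (by positivity)]
        rfl

variable [BorelSpace E] (μ : Measure E) [μ.IsAddHaarMeasure] [SFinite ν]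

lemma lintegral_truncated_kernel (hg : Integrable g ν) {r : ℝ} (hr : 0 ≤ r) :
    ∫⁻ x, ∫⁻ y, ‖g y‖ₑ *
        ENNReal.ofReal ((Metric.ball (0 : E) r).indicator radialKernel (x - y)) ∂ν ∂μ =
      ENNReal.ofReal ((∫ y, |g y| ∂ν) * (μ.toSphere.real Set.univ * r)) := by
  have hm : Measurable ((Metric.ball (0 : E) r).indicator (radialKernel : E → ℝ)) :=
    measurable_radialKernel.indicator measurableSet_ball
  have hgm : AEMeasurable (fun p : E × E ↦ ‖g p.2‖ₑ) (μ.prod ν) :=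
    (hg.1.aemeasurable.comp_quasiMeasurePreserving Measure.quasiMeasurePreserving_snd).enorm
  rw [lintegral_lintegral_swap]
  · have : ∀ y, ∫⁻ x, ‖g y‖ₑ *
        ENNReal.ofReal ((Metric.ball (0 : E) r).indicator radialKernel (x - y)) ∂μ =
        ‖g y‖ₑ * ENNReal.ofReal (μ.toSphere.real Set.univ * r) := by
      intro y
      rw [lintegral_const_mul _ (by fun_prop),
        lintegral_sub_right_eq_self
          (fun x ↦ ENNReal.ofReal ((Metric.ball (0 : E) r).indicator radialKernel x)) y,
        ← setIntegral_ball_radialKernel μ hr, ← integral_indicator measurableSet_ball,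
        ofReal_integral_eq_lintegral_ofReal
          ((integrable_indicator_iff measurableSet_ball).2 (integrableOn_ball_radialKernel μ r))
          (.of_forall fun z ↦ Set.indicator_nonneg (fun z _ ↦ radialKernel_nonneg z) _)]
    simp_rw [this]
    rw [lintegral_mul_const'' _ hg.1.aemeasurable.enorm,
      ← ofReal_integral_norm_eq_lintegral_enorm hg,
      ENNReal.ofReal_mul (integral_nonneg fun _ ↦ abs_nonneg _)]
    rfl
  · exact hgm.mul (Measurable.aemeasurable (by fun_prop))

/-- The weak-type `(1, d / (d - 1))` bound for kernels dominated by `‖z‖ ^ (1 - d)`. -/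
lemma measure_lt_abs_integral_kernel_le (hg : Integrable g ν)
    (hKle : ∀ z, |K z| ≤ radialKernel z) {r : ℝ} (hr : 0 < r) :
    μ {x | (r ^ (Module.finrank ℝ E - 1))⁻¹ *
        ((μ.toSphere.real Set.univ + 1) * ∫ y, |g y| ∂ν) < |∫ y, g y * K (x - y) ∂ν|} ≤
      ENNReal.ofReal (r ^ Module.finrank ℝ E) := by
  set d := Module.finrank ℝ E
  have hd : 0 < d := Module.finrank_pos
  set S := μ.toSphere.real Set.univ
  have hS : 0 < S := toSphere_real_univ_pos μ
  set I := ∫ y, |g y| ∂ν with hI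
  set R := (r ^ (d - 1))⁻¹ with hRdef
  have hR : 0 < R := by positivity
  have hI0 : 0 ≤ I := integral_nonneg fun _ ↦ abs_nonneg _
  rcases hI0.eq_or_lt with h0 | hpos
  · have hg0 : g =ᵐ[ν] 0 := by
      filter_upwards [(integral_eq_zero_iff_of_nonneg (fun _ ↦ abs_nonneg _) hg.abs).1 h0.symm]
        with y hy
      simpa using hy
    have : ∀ x, ∫ y, g y * K (x - y) ∂ν = 0 := fun x ↦ integral_eq_zero_of_ae <| by
      filter_upwards [hg0] with y hy
      simp [hy]
    simp [this, ← h0]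
  · set T : E → ℝ≥0∞ := fun x ↦ ∫⁻ y, ‖g y‖ₑ *
      ENNReal.ofReal ((Metric.ball (0 : E) r).indicator radialKernel (x - y)) ∂ν
    have hsub : {x | R * ((S + 1) * I) < |∫ y, g y * K (x - y) ∂ν|} ⊆
        {x | ENNReal.ofReal (R * S * I) ≤ T x} := by
      intro x hx
      by_contra hlt
      simp only [Set.mem_ofPred_eq, not_le] at hlt hx
      have h1 := enorm_integral_kernel_le hg hKle hr x
      rw [Real.enorm_eq_ofReal_abs] at h1
      have h2 : ENNReal.ofReal |∫ y, g y * K (x - y) ∂ν| ≤ ENNReal.ofReal (R * ((S + 1) * I)) := by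
        refine h1.trans ((add_le_add_left hlt.le _).trans ?_)
        rw [← ENNReal.ofReal_add (by positivity) (by positivity)]
        exact ENNReal.ofReal_le_ofReal (by linarith)
      exact absurd ((ENNReal.ofReal_le_ofReal_iff (by positivity)).1 h2) (not_le.2 hx)
    have hTm : AEMeasurable T μ := by
      have hm : Measurable ((Metric.ball (0 : E) r).indicator (radialKernel : E → ℝ)) :=
        measurable_radialKernel.indicator measurableSet_ball
      have hgm : AEMeasurable (fun p : E × E ↦ ‖g p.2‖ₑ) (μ.prod ν) :=
        (hg.1.aemeasurable.comp_quasiMeasurePreserving Measure.quasiMeasurePreserving_snd).enorm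
      exact AEMeasurable.lintegral_prod_right' (f := fun p : E × E ↦ ‖g p.2‖ₑ *
        ENNReal.ofReal ((Metric.ball (0 : E) r).indicator radialKernel (p.1 - p.2)))
        (hgm.mul (Measurable.aemeasurable (by fun_prop)))
    calc _ ≤ μ {x | ENNReal.ofReal (R * S * I) ≤ T x} := measure_mono hsub
      _ ≤ (∫⁻ x, T x ∂μ) / ENNReal.ofReal (R * S * I) :=
        meas_ge_le_lintegral_div hTm (by simp; positivity) ENNReal.ofReal_ne_top
      _ = _ := by
        rw [lintegral_truncated_kernel μ hg hr.le, ← ENNReal.ofReal_div_of_pos (by positivity)]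
        congr 1
        obtain ⟨m, hm⟩ := Nat.exists_eq_succ_of_ne_zero hd.ne'
        rw [hRdef, hm, Nat.succ_sub_one, Nat.succ_eq_add_one, pow_succ, ← hI]
        field_simp
        rfl

lemma integrable_kernel_prod (hg : Integrable g ν) (hK : Measurable K)
    (hKle : ∀ z, |K z| ≤ radialKernel z) {ψ : E → ℝ} (hψ : Integrable ψ μ) {M : ℝ}
    (hM : ∀ x, |ψ x| ≤ M) :
    Integrable (fun p : E × E ↦ g p.2 * K (p.1 - p.2) * ψ p.1) (μ.prod ν) := by
  have hdom : ∀ y, Integrable (fun x ↦ radialKernel (x - y) * |ψ x|) μ := fun y ↦ by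
    simpa using (integrable_radialKernel_mul μ (hψ.abs.comp_add_right y)
      (by simpa using fun x ↦ hM (x + y))).comp_sub_right y
  have hle : ∀ x y, ‖g y * K (x - y) * ψ x‖ ≤ |g y| * (radialKernel (x - y) * |ψ x|) := by
    intro x y
    rw [norm_mul, norm_mul, mul_assoc]
    exact mul_le_mul_of_nonneg_left
      (mul_le_mul_of_nonneg_right (hKle _) (abs_nonneg _)) (abs_nonneg _)
  have hgm : AEStronglyMeasurable (fun p : E × E ↦ g p.2) (μ.prod ν) := hg.1.comp_snd
  have hψm : AEStronglyMeasurable (fun p : E × E ↦ ψ p.1) (μ.prod ν) := hψ.1.comp_fst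
  have hKm : Measurable fun p : E × E ↦ K (p.1 - p.2) := by fun_prop
  have hmeas : AEStronglyMeasurable (fun p : E × E ↦ g p.2 * K (p.1 - p.2) * ψ p.1) (μ.prod ν) :=
    (hgm.mul hKm.aestronglyMeasurable).mul hψm
  have hsec : ∀ y, Integrable (fun x ↦ g y * K (x - y) * ψ x) μ := fun y ↦ by
    refine ((hdom y).const_mul |g y|).mono' ?_ (.of_forall fun x ↦ hle x y)
    have : Measurable fun x ↦ K (x - y) := by fun_prop
    exact (this.aestronglyMeasurable.const_mul _).mul hψ.1
  rw [integrable_prod_iff' hmeas]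
  refine ⟨.of_forall hsec, ?_⟩
  refine (hg.abs.mul_const (M * μ.toSphere.real Set.univ + ∫ z, |ψ z| ∂μ)).mono'
    hmeas.norm.prod_swap.integral_prod_right' (.of_forall fun y ↦ ?_)
  rw [Real.norm_of_nonneg (integral_nonneg fun _ ↦ norm_nonneg _)]
  calc ∫ x, ‖g y * K (x - y) * ψ x‖ ∂μ ≤ ∫ x, |g y| * (radialKernel (x - y) * |ψ x|) ∂μ :=
        integral_mono (hsec y).norm ((hdom y).const_mul _) fun x ↦ hle x y
    _ = |g y| * ∫ z, radialKernel z * |ψ (z + y)| ∂μ := by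
        rw [integral_const_mul,
          ← integral_sub_right_eq_self (fun z ↦ radialKernel z * |ψ (z + y)|) y]
        simp
    _ ≤ _ := by
        refine mul_le_mul_of_nonneg_left ?_ (abs_nonneg _)
        refine (integral_radialKernel_mul_abs_le μ (hψ.comp_add_right y) fun x ↦ hM _).trans_eq ?_
        rw [integral_add_right_eq_self (fun z ↦ |ψ z|)]

end WeakType

section Lorentz

variable {α : Type*} [MeasurableSpace α] {μ : Measure α}

@[simp]
lemma lorentzNorm_top_zero (p : ℝ) : lorentzNorm p ⊤ μ (fun _ ↦ 0) = 0 := by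
  have : ∀ t, rearr μ (fun _ ↦ 0) t = 0 := fun t ↦
    le_antisymm (sInf_le (by simp [distFn])) zero_le
  simp [lorentzNorm, this]

lemma lorentzNorm_top_le_of_measure_le {n : ℕ} (hn : 2 ≤ n) {G : α → ℝ} {A : ℝ} (hA : 0 ≤ A)
    (h : ∀ r : ℝ, 0 < r → μ {x | (r ^ (n - 1))⁻¹ * A < |G x|} ≤ ENNReal.ofReal (r ^ n)) :
    lorentzNorm ((n : ℝ) / (n - 1)) ⊤ μ G ≤ ENNReal.ofReal A := by
  rw [lorentzNorm, if_pos rfl]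
  refine iSup_le fun ⟨t, ht⟩ ↦ ?_
  have hn0 : (n : ℝ) ≠ 0 := by positivity
  set r := t ^ (1 / (n : ℝ)) with hr
  have hrpos : 0 < r := Real.rpow_pos_of_pos ht _
  have hrn : r ^ n = t := by
    rw [hr, ← Real.rpow_natCast, ← Real.rpow_mul ht.le]
    simp [hn0]
  have htp : t ^ (1 / ((n : ℝ) / (n - 1))) = r ^ (n - 1) := by
    rw [hr, ← Real.rpow_natCast, ← Real.rpow_mul ht.le, Nat.cast_sub (by omega), one_div_div]
    congr 1
    push_cast
    ring
  have hre : rearr μ G (ENNReal.ofReal t) ≤ ENNReal.ofReal ((r ^ (n - 1))⁻¹ * A) := by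
    refine sInf_le ?_
    rw [Set.mem_ofPred_eq, distFn, ← hrn]
    refine (measure_mono fun x hx ↦ ?_).trans (h r hrpos)
    rw [Set.mem_ofPred_eq, ← enorm_eq_nnnorm, Real.enorm_eq_ofReal_abs] at hx
    exact (ENNReal.ofReal_lt_ofReal_iff_of_nonneg (by positivity)).1 hx
  change ENNReal.ofReal (t ^ (1 / ((n : ℝ) / (n - 1)))) * _ ≤ _
  rw [htp]
  calc ENNReal.ofReal (r ^ (n - 1)) * rearr μ G (ENNReal.ofReal t)
      ≤ ENNReal.ofReal (r ^ (n - 1)) * ENNReal.ofReal ((r ^ (n - 1))⁻¹ * A) := by gcongr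
    _ = ENNReal.ofReal A := by
      rw [← ENNReal.ofReal_mul (by positivity), mul_inv_cancel_left₀ (by positivity)]

end Lorentz

lemma sum_pd_mul {n : ℕ} (φ : Rn n → ℝ) (x v : Rn n) :
    ∑ j, v j * pd j φ x = fderiv ℝ φ x v := by
  conv_rhs => rw [pi_eq_sum_univ' v, map_sum]
  refine Finset.sum_congr rfl fun j _ ↦ ?_
  rw [map_smul, pd, smul_eq_mul]

/-- The `j`-th component of the vector field `z / ‖z‖ ^ n`. -/
def radialField {n : ℕ} (j : Fin n) (z : Rn n) : ℝ := z j * (‖z‖ ^ n)⁻¹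

@[fun_prop]
lemma measurable_radialField {n : ℕ} (j : Fin n) : Measurable (radialField j) := by
  unfold radialField
  fun_prop

lemma abs_radialField_le {n : ℕ} (j : Fin n) (z : Rn n) : |radialField j z| ≤ radialKernel z := by
  rw [radialField, radialKernel, Module.finrank_fin_fun, abs_mul, abs_of_nonneg (a := (_)⁻¹)
    (by positivity)]
  gcongr
  exact norm_le_pi_norm z j

/-- Distributional identity `∑ j, ∂ⱼ (g * radialField j) = σ g`, with `σ` the total mass of the
sphere measure. -/
lemma sum_integral_radialField_mul_pd {n : ℕ} [Nontrivial (Rn n)] {ν : Measure (Rn n)} [SFinite ν]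
    {g : Rn n → ℝ} (hg : Integrable g ν) {φ : Rn n → ℝ} (hφ : ContDiff ℝ 1 φ)
    (hc : HasCompactSupport φ) :
    ∑ j, ∫ x, (∫ y, g y * radialField j (x - y) ∂ν) * pd j φ x =
      -((volume : Measure (Rn n)).toSphere.real Set.univ * ∫ y, g y * φ y ∂ν) := by
  have hcont : ∀ j : Fin n, Continuous (pd j φ) := fun j ↦
    (hφ.continuous_fderiv one_ne_zero).clm_apply continuous_const
  have hsupp : ∀ j : Fin n, HasCompactSupport (pd j φ) := fun j ↦ hc.fderiv_apply (𝕜 := ℝ) _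
  have hpdi : ∀ j : Fin n, Integrable (pd j φ) volume := fun j ↦
    (hcont j).integrable_of_hasCompactSupport (hsupp j)
  have hprod : ∀ j : Fin n, Integrable
      (fun p : Rn n × Rn n ↦ g p.2 * radialField j (p.1 - p.2) * pd j φ p.1)
      (volume.prod ν) := fun j ↦ by
    obtain ⟨M, hM⟩ := (hcont j).bounded_above_of_compact_support (hsupp j)
    exact integrable_kernel_prod volume hg (measurable_radialField j) (abs_radialField_le j)
      (hpdi j) hM
  have hswap : ∀ j : Fin n, ∫ x, (∫ y, g y * radialField j (x - y) ∂ν) * pd j φ x =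
      ∫ y, (∫ x, g y * radialField j (x - y) * pd j φ x) ∂ν := fun j ↦ by
    simp_rw [← integral_mul_const]
    exact integral_integral_swap
      (f := fun x y ↦ g y * radialField j (x - y) * pd j φ x) (hprod j)
  have hae : ∀ᵐ y ∂ν, ∀ j : Fin n,
      Integrable (fun x ↦ g y * radialField j (x - y) * pd j φ x) volume :=
    ae_all_iff.2 fun j ↦ (hprod j).prod_left_ae
  simp_rw [hswap]
  rw [← integral_finsetSum (f := fun j y ↦ ∫ x, g y * radialField j (x - y) * pd j φ x) _
      fun j _ ↦ (hprod j).integral_prod_right,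
    ← integral_const_mul, ← integral_neg]
  refine integral_congr_ae ?_
  filter_upwards [hae] with y hy
  rw [← integral_finsetSum _ fun j _ ↦ hy j]
  have hpt : ∀ x, ∑ j, g y * radialField j (x - y) * pd j φ x =
      g y * (fderiv ℝ φ x (x - y) * (‖x - y‖ ^ n)⁻¹) := fun x ↦ by
    rw [← sum_pd_mul, Finset.sum_mul, Finset.mul_sum]
    refine Finset.sum_congr rfl fun j _ ↦ ?_
    rw [radialField]
    ring
  simp_rw [hpt]
  rw [integral_const_mul,
    ← integral_add_left_eq_self (fun x ↦ fderiv ℝ φ x (x - y) * (‖x - y‖ ^ n)⁻¹) y]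
  have key := integral_fderiv_apply_mul_radial volume hφ hc y
  rw [Module.finrank_fin_fun] at key
  simp only [add_sub_cancel_left]
  rw [key]
  ring

/- STATEMENT 6: every `f ∈ L¹(U)` belongs to `W^{−1,(n/(n−1),∞)}(U)`, i.e. `f` admits a
representation `f = f₀ + Σ_j ∂_j f_j` (in the sense of distributions on `U`) with
`f₀, f_j ∈ L^{n/(n−1),∞}(U)` and total Lorentz norm at most `C(n) ‖f‖_{L¹(U)}`. -/
theorem L1_mem_negative_sobolev_lorentz (n : ℕ) (hn : 2 ≤ n) :
    ∃ C : ℝ, 0 < C ∧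
      ∀ U : Set (Rn n), IsOpen U →
        ∀ f : Rn n → ℝ, IntegrableOn f U volume →
          ∃ (f₀ : Rn n → ℝ) (F : Fin n → Rn n → ℝ),
            Measurable f₀ ∧ (∀ j, Measurable (F j)) ∧
            lorentzNorm ((n : ℝ) / (n - 1)) ⊤ (volume.restrict U) f₀ +
                ∑ j : Fin n, lorentzNorm ((n : ℝ) / (n - 1)) ⊤ (volume.restrict U) (F j) ≤
              ENNReal.ofReal (C * ∫ x in U, |f x|) ∧
            ∀ φ : Rn n → ℝ, IsTest U φ →
              ∫ x in U, f x * φ x =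
                (∫ x in U, f₀ x * φ x) - ∑ j : Fin n, ∫ x in U, F j x * pd j φ x := by
  have : Nonempty (Fin n) := ⟨⟨0, by omega⟩⟩
  set S := (volume : Measure (Rn n)).toSphere.real Set.univ
  have hS : 0 < S := toSphere_real_univ_pos _
  refine ⟨n * ((S + 1) * S⁻¹),
    mul_pos (by positivity) (mul_pos (by positivity) (inv_pos.2 hS)), fun U _ f hf ↦ ?_⟩
  obtain ⟨f', hfm, hff⟩ := hf.aestronglyMeasurable
  set g : Rn n → ℝ := fun y ↦ S⁻¹ * f' y with hg
  have hfg : f =ᵐ[volume.restrict U] fun y ↦ S * g y := by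
    filter_upwards [hff] with y hy
    rw [hg, mul_inv_cancel_left₀ hS.ne', ← hy]
  have hgm : StronglyMeasurable g := hfm.const_mul _
  have hgi : Integrable g (volume.restrict U) := (hf.congr hff).const_mul _
  have hgI : ∫ y in U, |g y| = S⁻¹ * ∫ x in U, |f x| := by
    rw [← integral_const_mul]
    refine integral_congr_ae ?_
    filter_upwards [hfg] with y hy
    change |g y| = S⁻¹ * |f y|
    rw [hy, abs_mul S, abs_of_pos hS, inv_mul_cancel_left₀ hS.ne']
  set I := ∫ x in U, |f x| with hI
  have hI0 : 0 ≤ I := integral_nonneg fun _ ↦ abs_nonneg _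
  set F : Fin n → Rn n → ℝ := fun j x ↦ ∫ y in U, g y * radialField j (x - y) with hF
  refine ⟨fun _ ↦ 0, F, measurable_const, fun j ↦ ?_, ?_, fun φ ⟨hφ, hc, hsupp⟩ ↦ ?_⟩
  · have hm : Measurable fun p : Rn n × Rn n ↦ g p.2 * radialField j (p.1 - p.2) := by
      have := hgm.measurable
      fun_prop
    exact hm.stronglyMeasurable.integral_prod_right'.measurable
  · have hj : ∀ j, lorentzNorm ((n : ℝ) / (n - 1)) ⊤ (volume.restrict U) (F j) ≤
        ENNReal.ofReal ((S + 1) * (S⁻¹ * I)) := fun j ↦ by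
      refine lorentzNorm_top_le_of_measure_le hn (by positivity) fun r hr ↦ ?_
      have key := measure_lt_abs_integral_kernel_le volume hgi (abs_radialField_le j) hr
      rw [Module.finrank_fin_fun, hgI] at key
      exact (Measure.restrict_apply_le _ _).trans key
    rw [lorentzNorm_top_zero, zero_add]
    refine (Finset.sum_le_sum fun j _ ↦ hj j).trans_eq ?_
    rw [Finset.sum_const, Finset.card_univ, Fintype.card_fin, ← ENNReal.ofReal_nsmul, nsmul_eq_mul]
    congr 1
    ring
  · have hout : ∀ j, ∫ x in U, F j x * pd j φ x = ∫ x, F j x * pd j φ x := fun j ↦ by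
      refine setIntegral_eq_integral_of_forall_compl_eq_zero fun x hx ↦ ?_
      have : fderiv ℝ φ x = 0 := fderiv_of_notMem_tsupport ℝ fun h ↦ hx (hsupp h)
      simp [pd, this]
    simp_rw [hout]
    rw [hF, sum_integral_radialField_mul_pd hgi (hφ.of_le (by exact_mod_cast le_top)) hc]
    simp only [zero_mul, integral_zero, zero_sub, neg_neg]
    rw [← integral_const_mul]
    refine integral_congr_ae ?_
    filter_upwards [hfg] with y hy
    rw [hy, mul_assoc]

end
end

section
/- Let n ≥ 2, Λ ≥ 1, and let U ⊂ ℝ^n be a bounded open set. Let g = (g_{ij}) ∈ L^∞ ∩ W^{1,n}(U, ℝ^{n×n}_{sym}) satisfy Λ^{−1}|ξ|² ≤ g_{ij}(x) ξ^i ξ^j ≤ Λ|ξ|² for a.e. x and all ξ ∈ ℝ^n. Then there exist measurable vector fields e₁,…,e_n on U such that a.e.: ⟨e_i, e_j⟩_g = δ_{ij}; |e_i| ≤ C(Λ); and |∇e_i| ≤ C(Λ)|∇g|; in particular e_i ∈ L^∞ ∩ W^{1,n}(U, ℝ^n). -/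
open MeasureTheory ENNReal

noncomputable section

/-- `h` is the weak `j`-th partial derivative of `f` on the open set `U`. -/
def HasWeakPD {n : ℕ} (U : Set (Rn n)) (f h : Rn n → ℝ) (j : Fin n) : Prop :=
  ∀ φ : Rn n → ℝ, IsTest U φ → ∫ x in U, f x * pd j φ x = -∫ x in U, h x * φ x

/-- The coefficients of the binomial series of `(1 - x) ^ (-1 / 2)`. -/
def invSqrtCoeff : ℕ → ℝ
  | 0 => 1
  | m + 1 => invSqrtCoeff m * ((2 * m + 1) / (2 * m + 2))

lemma invSqrtCoeff_succ (m : ℕ) :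
    (m + 1) * invSqrtCoeff (m + 1) = (m + 1 / 2) * invSqrtCoeff m := by
  rw [invSqrtCoeff]
  field_simp

lemma invSqrtCoeff_nonneg (m : ℕ) : 0 ≤ invSqrtCoeff m := by
  induction m with
  | zero => simp [invSqrtCoeff]
  | succ m ih => rw [invSqrtCoeff]; positivity

lemma invSqrtCoeff_le_one (m : ℕ) : invSqrtCoeff m ≤ 1 := by
  induction m with
  | zero => simp [invSqrtCoeff]
  | succ m ih =>
    rw [invSqrtCoeff]
    refine mul_le_one₀ ih (by positivity) ?_
    rw [div_le_one (by positivity)]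
    linarith

lemma sum_antidiagonal_invSqrtCoeff (m : ℕ) :
    ∑ p ∈ Finset.HasAntidiagonal.antidiagonal m, invSqrtCoeff p.1 * invSqrtCoeff p.2 = 1 := by
  have symm (m : ℕ) :
      ∑ p ∈ Finset.HasAntidiagonal.antidiagonal m,
          (p.2 : ℝ) * (invSqrtCoeff p.1 * invSqrtCoeff p.2) =
        ∑ p ∈ Finset.HasAntidiagonal.antidiagonal m,
          (p.1 : ℝ) * (invSqrtCoeff p.1 * invSqrtCoeff p.2) := by
    rw [← Finset.Nat.sum_antidiagonal_swap]
    exact Finset.sum_congr rfl fun p _ => by simp [mul_comm]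
  have weight (m : ℕ) :
      (m : ℝ) * ∑ p ∈ Finset.HasAntidiagonal.antidiagonal m, invSqrtCoeff p.1 * invSqrtCoeff p.2 =
        2 * ∑ p ∈ Finset.HasAntidiagonal.antidiagonal m,
          (p.1 : ℝ) * (invSqrtCoeff p.1 * invSqrtCoeff p.2) := by
    rw [two_mul]
    nth_rw 2 [← symm]
    rw [← Finset.sum_add_distrib, Finset.mul_sum]
    refine Finset.sum_congr rfl fun p hp => ?_
    rw [← Finset.HasAntidiagonal.mem_antidiagonal.mp hp]
    push_cast
    ring
  induction m with
  | zero => simp [invSqrtCoeff]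
  | succ m ih =>
    have h := weight (m + 1)
    rw [Finset.Nat.sum_antidiagonal_succ (n := m)
      (f := fun p : ℕ × ℕ => (p.1 : ℝ) * (invSqrtCoeff p.1 * invSqrtCoeff p.2))] at h
    have step : ∀ p : ℕ × ℕ,
        ((p.1 + 1 : ℕ) : ℝ) * (invSqrtCoeff (p.1 + 1) * invSqrtCoeff p.2) =
          p.1 * (invSqrtCoeff p.1 * invSqrtCoeff p.2) +
            1 / 2 * (invSqrtCoeff p.1 * invSqrtCoeff p.2) := by
      intro p
      have := invSqrtCoeff_succ p.1
      push_cast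
      linear_combination invSqrtCoeff p.2 * this
    simp only [step, Finset.sum_add_distrib, ← Finset.mul_sum, ih] at h
    have h' := weight m
    rw [ih] at h'
    push_cast at h
    have hm : (m : ℝ) + 1 ≠ 0 := by positivity
    refine mul_left_cancel₀ hm ?_
    linarith

open scoped Matrix.Norms.Frobenius

lemma frobenius_norm_sq {m n : Type*} [Fintype m] [Fintype n] (M : Matrix m n ℝ) :
    ‖M‖ ^ 2 = ∑ i, ∑ j, M i j ^ 2 := by
  rw [Matrix.frobenius_norm_def, ← Real.sqrt_eq_rpow, Real.sq_sqrt (by positivity)]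
  simp

/-- `A` acts with norm at most `q` on matrices, on either side, for the Frobenius norm. -/
def OpBound {n : ℕ} (A : Matrix (Fin n) (Fin n) ℝ) (q : ℝ) : Prop :=
  ∀ B : Matrix (Fin n) (Fin n) ℝ, ‖A * B‖ ≤ q * ‖B‖ ∧ ‖B * A‖ ≤ q * ‖B‖

lemma OpBound.of_quadratic {n : ℕ} {A : Matrix (Fin n) (Fin n) ℝ} {q : ℝ} (hq : 0 < q)
    (hA : A.IsSymm)
    (h : ∀ v : Fin n → ℝ, 0 ≤ v ⬝ᵥ A.mulVec v ∧ v ⬝ᵥ A.mulVec v ≤ q * (v ⬝ᵥ v)) :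
    OpBound A q := by
  have vec (v : Fin n → ℝ) : A.mulVec v ⬝ᵥ A.mulVec v ≤ q ^ 2 * (v ⬝ᵥ v) := by
    set y := A.mulVec v with hy
    have h1 := (h (v - q⁻¹ • y)).1
    have h2 := (h v).2
    have h3 := (h y).2
    have h4 : v ⬝ᵥ A.mulVec y = y ⬝ᵥ y := by
      rw [Matrix.dotProduct_mulVec, ← Matrix.mulVec_transpose, hA.eq]
    rw [Matrix.mulVec_sub, Matrix.mulVec_smul, ← hy] at h1
    simp only [sub_dotProduct, dotProduct_sub, smul_dotProduct, dotProduct_smul, smul_eq_mul,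
      h4] at h1
    rw [← hy] at h2
    have h5 : q⁻¹ * (q⁻¹ * (y ⬝ᵥ A.mulVec y)) ≤ q⁻¹ * (y ⬝ᵥ y) := by
      gcongr
      rw [inv_mul_le_iff₀ hq]
      exact h3
    have h6 : q⁻¹ * (y ⬝ᵥ y) ≤ q * (v ⬝ᵥ v) := by linarith
    rw [inv_mul_le_iff₀ hq] at h6
    linarith
  have left (B : Matrix (Fin n) (Fin n) ℝ) : ‖A * B‖ ≤ q * ‖B‖ := by
    refine (sq_le_sq₀ (norm_nonneg _) (by positivity)).mp ?_
    rw [mul_pow, frobenius_norm_sq, frobenius_norm_sq, Finset.sum_comm,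
      Finset.sum_comm (f := fun i j => B i j ^ 2), Finset.mul_sum]
    refine Finset.sum_le_sum fun j _ => ?_
    have := vec (B.col j)
    simpa [dotProduct, Matrix.mulVec, Matrix.mul_apply, pow_two] using this
  refine fun B => ⟨left B, ?_⟩
  have := left B.transpose
  rwa [Matrix.frobenius_norm_transpose, ← Matrix.frobenius_norm_transpose, Matrix.transpose_mul,
    Matrix.transpose_transpose, hA.eq] at this

/-- The derivative of `A ↦ A ^ m` at `A` in the direction `B`. -/
def powDeriv {R : Type*} [Ring R] (A B : R) : ℕ → R
  | 0 => 0
  | m + 1 => powDeriv A B m * A + A ^ m * B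

lemma OpBound.norm_pow_mul_le {n : ℕ} {A : Matrix (Fin n) (Fin n) ℝ} {q : ℝ} (hq : 0 ≤ q)
    (h : OpBound A q) (B : Matrix (Fin n) (Fin n) ℝ) (m : ℕ) : ‖A ^ m * B‖ ≤ q ^ m * ‖B‖ := by
  induction m with
  | zero => simp
  | succ m ih =>
    rw [pow_succ', Matrix.mul_assoc, pow_succ', mul_assoc]
    exact ((h _).1).trans (by gcongr)

lemma OpBound.norm_powDeriv_le {n : ℕ} {A : Matrix (Fin n) (Fin n) ℝ} {q : ℝ} (hq : 0 ≤ q)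
    (h : OpBound A q) (B : Matrix (Fin n) (Fin n) ℝ) (m : ℕ) :
    ‖powDeriv A B m‖ ≤ m * q ^ (m - 1) * ‖B‖ := by
  induction m with
  | zero => simp [powDeriv]
  | succ m ih =>
    rw [powDeriv]
    refine (norm_add_le _ _).trans ?_
    have h1 := ((h (powDeriv A B m)).2).trans (mul_le_mul_of_nonneg_left ih hq)
    have h2 := h.norm_pow_mul_le hq B m
    have h3 : q * (m * q ^ (m - 1) * ‖B‖) = m * q ^ m * ‖B‖ := by
      cases m with
      | zero => simp
      | succ k => simp only [Nat.add_sub_cancel]; ring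
    rw [h3] at h1
    rw [Nat.add_sub_cancel]
    push_cast
    linarith

lemma summable_nat_mul_pow_pred {q : ℝ} (hq : 0 ≤ q) (hq1 : q < 1) :
    Summable fun m : ℕ => (m : ℝ) * q ^ (m - 1) := by
  rw [← summable_nat_add_iff 1]
  have h1 : Summable fun m : ℕ => (m : ℝ) * q ^ m := by
    simpa using summable_pow_mul_geometric_of_norm_lt_one (R := ℝ) 1
      (by rwa [Real.norm_of_nonneg hq])
  refine (h1.add (summable_geometric_of_lt_one hq hq1)).congr fun m => ?_
  rw [Nat.add_sub_cancel]
  push_cast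
  ring

section NormedRing

variable {R : Type*} [NormedRing R] [NormedAlgebra ℝ R]

/-- The binomial series of `(1 - A) ^ (-1 / 2)`. -/
def invSqrtSeries (A : R) : R :=
  ∑' m, invSqrtCoeff m • A ^ m

/-- The termwise derivative of `invSqrtSeries` at `A` in the direction `B`. -/
def invSqrtSeriesDeriv (A B : R) : R :=
  ∑' m, invSqrtCoeff m • powDeriv A B m

lemma commute_invSqrtSeries (A : R) : Commute A (invSqrtSeries A) :=
  Commute.tsum_right _ fun m => ((Commute.refl A).pow_right m).smul_right _

lemma norm_invSqrtCoeff_smul_le {E : Type*} [NormedAddCommGroup E] [NormedSpace ℝ E] (m : ℕ)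
    (v : E) : ‖invSqrtCoeff m • v‖ ≤ ‖v‖ := by
  rw [norm_smul, Real.norm_of_nonneg (invSqrtCoeff_nonneg m)]
  exact mul_le_of_le_one_left (norm_nonneg _) (invSqrtCoeff_le_one m)

lemma one_sub_mul_invSqrtSeries_sq [CompleteSpace R] {A : R} (hA : Summable fun m => ‖A ^ m‖) :
    (1 - A) * (invSqrtSeries A * invSqrtSeries A) = 1 := by
  have hs : Summable fun m => ‖invSqrtCoeff m • A ^ m‖ :=
    .of_nonneg_of_le (fun _ => norm_nonneg _) (fun m => norm_invSqrtCoeff_smul_le m _) hA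
  have hsq : invSqrtSeries A * invSqrtSeries A = ∑' m, A ^ m := by
    rw [invSqrtSeries, tsum_mul_tsum_eq_tsum_sum_antidiagonal_of_summable_norm hs hs]
    congr 1
    ext1 m
    rw [← one_smul ℝ (A ^ m), ← sum_antidiagonal_invSqrtCoeff m, Finset.sum_smul]
    refine Finset.sum_congr rfl fun p hp => ?_
    rw [← Finset.HasAntidiagonal.mem_antidiagonal.mp hp, pow_add, smul_mul_smul_comm]
  rw [hsq, hA.of_norm.one_sub_mul_tsum_pow]

end NormedRing

section Series

variable {n : ℕ} {A : Matrix (Fin n) (Fin n) ℝ} {q : ℝ}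

lemma OpBound.norm_pow_le (hq : 0 ≤ q) (h : OpBound A q) (m : ℕ) :
    ‖A ^ m‖ ≤ q ^ m * ‖(1 : Matrix (Fin n) (Fin n) ℝ)‖ := by
  simpa using h.norm_pow_mul_le hq 1 m

lemma OpBound.summable_norm (hq : 0 ≤ q) (hq1 : q < 1) (h : OpBound A q) :
    Summable fun m => ‖invSqrtCoeff m • A ^ m‖ :=
  .of_nonneg_of_le (fun _ => norm_nonneg _)
    (fun m => (norm_invSqrtCoeff_smul_le m _).trans (h.norm_pow_le hq m))
    ((summable_geometric_of_lt_one hq hq1).mul_right _)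

lemma OpBound.summable_deriv_norm (hq : 0 ≤ q) (hq1 : q < 1) (h : OpBound A q)
    (B : Matrix (Fin n) (Fin n) ℝ) :
    Summable fun m => ‖invSqrtCoeff m • powDeriv A B m‖ :=
  .of_nonneg_of_le (fun _ => norm_nonneg _)
    (fun m => (norm_invSqrtCoeff_smul_le m _).trans (h.norm_powDeriv_le hq B m))
    ((summable_nat_mul_pow_pred hq hq1).mul_right _)

lemma OpBound.norm_invSqrtSeriesDeriv_le (hq : 0 ≤ q) (hq1 : q < 1) (h : OpBound A q)
    (B : Matrix (Fin n) (Fin n) ℝ) :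
    ‖invSqrtSeriesDeriv A B‖ ≤ (∑' m : ℕ, (m : ℝ) * q ^ (m - 1)) * ‖B‖ := by
  rw [← tsum_mul_right]
  exact tsum_of_norm_bounded ((summable_nat_mul_pow_pred hq hq1).mul_right _).hasSum
    fun m => (norm_invSqrtCoeff_smul_le m _).trans (h.norm_powDeriv_le hq B m)

lemma OpBound.one_sub_mul_invSqrtSeries_sq (hq : 0 ≤ q) (hq1 : q < 1) (h : OpBound A q) :
    (1 - A) * (invSqrtSeries A * invSqrtSeries A) = 1 :=
  _root_.one_sub_mul_invSqrtSeries_sq <|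
    .of_nonneg_of_le (fun _ => norm_nonneg _) (h.norm_pow_le hq)
      ((summable_geometric_of_lt_one hq hq1).mul_right _)

lemma invSqrtSeries_isSymm (hA : A.IsSymm) : (invSqrtSeries A).IsSymm := by
  refine Matrix.transpose_tsum.trans (tsum_congr fun m => ?_)
  rw [Matrix.transpose_smul, Matrix.transpose_pow, hA.eq]

end Series

lemma locallyIntegrable_of_bound {n : ℕ} {f : Rn n → ℝ} {B : ℝ} (hf : Measurable f)
    (hB : ∀ x, |f x| ≤ B) : LocallyIntegrable f :=
  (memLp_top_of_bound hf.aestronglyMeasurable B (.of_forall hB)).locallyIntegrable le_top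

section Mollification

variable {n : ℕ} (ρ : ContDiffBump (0 : Rn n))

/-- The mollification of `f` by the normed bump function `ρ`. -/
def mollify (f : Rn n → ℝ) : Rn n → ℝ :=
  convolution f (ρ.normed volume) (ContinuousLinearMap.mul ℝ ℝ) volume

lemma mollify_apply (f : Rn n → ℝ) (x : Rn n) :
    mollify ρ f x = ∫ t, f t * ρ.normed volume (x - t) := rfl

lemma convolution_normed_eq_mollify (f : Rn n → ℝ) (x : Rn n) :
    convolution (ρ.normed volume) f (ContinuousLinearMap.lsmul ℝ ℝ) volume x = mollify ρ f x := by
  rw [convolution_eq_swap, mollify_apply]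
  simp [mul_comm]

variable {f : Rn n → ℝ}

open scoped ContDiff in
lemma contDiff_mollify (hf : LocallyIntegrable f) : ContDiff ℝ ∞ (mollify ρ f) :=
  ρ.hasCompactSupport_normed.contDiff_convolution_right _ hf ρ.contDiff_normed

lemma continuous_pd {φ : Rn n → ℝ} (hφ : ContDiff ℝ 1 φ) (j : Fin n) : Continuous (pd j φ) :=
  (hφ.continuous_fderiv one_ne_zero).clm_apply continuous_const

lemma hasCompactSupport_pd {φ : Rn n → ℝ} (hφ : HasCompactSupport φ) (j : Fin n) :
    HasCompactSupport (pd j φ) :=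
  hφ.fderiv_apply (𝕜 := ℝ) _

lemma pd_eq_zero_of_notMem_tsupport {φ : Rn n → ℝ} {x : Rn n} (hx : x ∉ tsupport φ) (j : Fin n) :
    pd j φ x = 0 := by
  rw [pd, image_eq_zero_of_notMem_tsupport (fun h => hx (tsupport_fderiv_subset ℝ h))]
  simp

lemma pd_mollify (hf : LocallyIntegrable f) (j : Fin n) (x : Rn n) :
    pd j (mollify ρ f) x = ∫ t, f t * pd j (ρ.normed volume) (x - t) := by
  have hρ : ContDiff ℝ 1 (ρ.normed volume) := ρ.contDiff_normed
  rw [pd, mollify, (ρ.hasCompactSupport_normed.hasFDerivAt_convolution_right _ hf hρ x).fderiv,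
    convolution_precompR_apply _ hf (ρ.hasCompactSupport_normed.fderiv ℝ)
      (hρ.continuous_fderiv one_ne_zero)]
  rfl

lemma pd_normed_neg (j : Fin n) (x : Rn n) :
    pd j (ρ.normed volume) (-x) = -pd j (ρ.normed volume) x := by
  have h : (fun y => ρ.normed volume (-y)) = ρ.normed volume := funext ρ.normed_neg
  have hρ : ContDiff ℝ 1 (ρ.normed volume) := ρ.contDiff_normed
  have hd := ((hρ.differentiable one_ne_zero (-x)).hasFDerivAt.comp x
    (hasFDerivAt_id x).neg).fderiv
  have hc : ρ.normed volume ∘ Neg.neg = ρ.normed volume := h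
  rw [hc] at hd
  simp [pd, hd]

lemma abs_mollify_le {B : ℝ} (hB : ∀ x, |f x| ≤ B) (x : Rn n) : |mollify ρ f x| ≤ B := by
  have hbound : Integrable fun t => B * ρ.normed volume (x - t) :=
    (ρ.integrable_normed.comp_sub_left x).const_mul B
  calc |mollify ρ f x| ≤ ∫ t, B * ρ.normed volume (x - t) := by
        rw [mollify_apply, ← Real.norm_eq_abs]
        refine norm_integral_le_of_norm_le hbound (.of_forall fun t => ?_)
        rw [norm_mul, Real.norm_eq_abs, Real.norm_of_nonneg (ρ.nonneg_normed _)]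
        exact mul_le_mul_of_nonneg_right (hB t) (ρ.nonneg_normed _)
    _ = B := by
        rw [integral_const_mul, integral_sub_left_eq_self (fun t => ρ.normed volume t),
          ρ.integral_normed, mul_one]

lemma tsupport_mollify_subset {K : Set (Rn n)} (hK : IsCompact K) (hf : ∀ x ∉ K, f x = 0) :
    tsupport (mollify ρ f) ⊆ Metric.cthickening ρ.rOut K := by
  refine closure_minimal ?_ Metric.isClosed_cthickening
  rw [← IsCompact.add_closedBall_zero hK ρ.rOut_pos.le]
  refine (support_convolution_subset (L := ContinuousLinearMap.mul ℝ ℝ)).trans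
    (Set.add_subset_add ?_ ?_)
  · exact fun x hx => by_contra fun h => hx (hf x h)
  · rw [ρ.support_normed_eq]
    exact Metric.ball_subset_closedBall

lemma integral_mul_pd_mollify {u : Rn n → ℝ} {B : ℝ} (hu : Integrable u) (hf : Measurable f)
    (hB : ∀ x, |f x| ≤ B) (j : Fin n) :
    ∫ x, u x * pd j (mollify ρ f) x = -∫ x, f x * pd j (mollify ρ u) x := by
  have hρ : ContDiff ℝ 1 (ρ.normed volume) := ρ.contDiff_normed
  have hρi : Integrable (pd j (ρ.normed volume)) :=
    (continuous_pd hρ j).integrable_of_hasCompactSupport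
      (hasCompactSupport_pd ρ.hasCompactSupport_normed j)
  have hprod : Integrable (fun p : Rn n × Rn n => f p.1 *
      (u p.2 * pd j (ρ.normed volume) (p.1 - p.2))) (volume.prod volume) :=
    (Integrable.convolution_integrand (ContinuousLinearMap.mul ℝ ℝ) hu hρi).bdd_mul
      (hf.comp measurable_fst).aestronglyMeasurable (.of_forall fun p => hB p.1)
  have hprod' : Integrable (Function.uncurry fun x t : Rn n =>
      u x * (f t * pd j (ρ.normed volume) (x - t))) (volume.prod volume) := by
    refine hprod.swap.neg.congr (.of_forall fun p => ?_)
    simp only [Pi.neg_apply, Function.comp_apply, Prod.fst_swap, Prod.snd_swap,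
      Function.uncurry]
    rw [← neg_sub p.1 p.2, pd_normed_neg]
    ring
  simp_rw [pd_mollify ρ (locallyIntegrable_of_bound hf hB), pd_mollify ρ hu.locallyIntegrable,
    ← integral_const_mul]
  rw [integral_integral_swap hprod', ← integral_neg]
  refine integral_congr_ae (.of_forall fun x => ?_)
  simp only
  rw [← integral_neg]
  refine integral_congr_ae (.of_forall fun t => ?_)
  simp only
  rw [← neg_sub t x, pd_normed_neg]
  ring

end Mollification

lemma pd_mul {n : ℕ} {f g : Rn n → ℝ} {x : Rn n} (hf : DifferentiableAt ℝ f x)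
    (hg : DifferentiableAt ℝ g x) (j : Fin n) :
    pd j (fun y => f y * g y) x = f x * pd j g x + pd j f x * g x := by
  rw [pd, fderiv_fun_mul hf hg]
  simp [pd, mul_comm]

lemma IsTest.continuous {n : ℕ} {U : Set (Rn n)} {φ : Rn n → ℝ} (h : IsTest U φ) :
    Continuous φ := h.1.continuous

lemma IsTest.contDiff_one {n : ℕ} {U : Set (Rn n)} {φ : Rn n → ℝ} (h : IsTest U φ) :
    ContDiff ℝ 1 φ := h.1.of_le (by exact_mod_cast le_top)

lemma IsTest.integrable_pd {n : ℕ} {U : Set (Rn n)} {φ : Rn n → ℝ} (h : IsTest U φ) (j : Fin n) :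
    Integrable (pd j φ) :=
  (continuous_pd h.contDiff_one j).integrable_of_hasCompactSupport (hasCompactSupport_pd h.2.1 j)

lemma IsTest.exists_bound {n : ℕ} {U : Set (Rn n)} {φ : Rn n → ℝ} (h : IsTest U φ) :
    ∃ M, ∀ x, |φ x| ≤ M :=
  h.2.1.exists_bound_of_continuous h.continuous

lemma IsTest.integrable_mul {n : ℕ} {U : Set (Rn n)} {φ h : Rn n → ℝ} (hφ : IsTest U φ)
    (hh : IntegrableOn h U) : IntegrableOn (fun x => h x * φ x) U := by
  obtain ⟨M, hM⟩ := hφ.exists_bound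
  exact Integrable.mul_bdd hh hφ.continuous.aestronglyMeasurable (.of_forall hM)

lemma IsTest.integrable_mul_pd {n : ℕ} {U : Set (Rn n)} {φ f : Rn n → ℝ} {B : ℝ}
    (hφ : IsTest U φ) (hf : AEStronglyMeasurable f (volume.restrict U)) (hB : ∀ x, |f x| ≤ B)
    (j : Fin n) : IntegrableOn (fun x => f x * pd j φ x) U :=
  ((hφ.integrable_pd j).integrableOn (s := U)).bdd_mul hf (.of_forall hB)

/-- Product rule for weak derivatives of bounded functions. -/
lemma HasWeakPD.mul {n : ℕ} {U : Set (Rn n)} (hU : IsOpen U) {f₁ f₂ h₁ h₂ : Rn n → ℝ}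
    {B₁ B₂ : ℝ} {j : Fin n} (hf₁ : Measurable f₁) (hf₂ : Measurable f₂)
    (hB₁ : ∀ x, |f₁ x| ≤ B₁) (hB₂ : ∀ x, |f₂ x| ≤ B₂)
    (hh₁ : IntegrableOn h₁ U) (hh₂ : IntegrableOn h₂ U)
    (hw₁ : HasWeakPD U f₁ h₁ j) (hw₂ : HasWeakPD U f₂ h₂ j) :
    HasWeakPD U (fun x => f₁ x * f₂ x) (fun x => h₁ x * f₂ x + f₁ x * h₂ x) j := by
  intro φ hφ
  obtain ⟨M, hM⟩ := hφ.exists_bound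
  have hB₁0 : 0 ≤ B₁ := (abs_nonneg _).trans (hB₁ 0)
  have hB₂0 : 0 ≤ B₂ := (abs_nonneg _).trans (hB₂ 0)
  obtain ⟨δ, hδ, hδU⟩ := hφ.2.1.isCompact.exists_cthickening_subset_open hU hφ.2.2
  let r : ℕ → ℝ := fun k => δ / (k + 1)
  have hr : ∀ k, 0 < r k := fun k => by positivity
  have hrδ : ∀ k, r k ≤ δ := fun k => div_le_self hδ.le (by linarith [k.cast_nonneg (α := ℝ)])
  let ρ : ℕ → ContDiffBump (0 : Rn n) := fun k => ⟨r k / 2, r k, by linarith [hr k],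
    by linarith [hr k]⟩
  have hρ0 : Filter.Tendsto (fun k => (ρ k).rOut) Filter.atTop (nhds 0) := by
    have := (tendsto_one_div_add_atTop_nhds_zero_nat (𝕜 := ℝ)).const_mul δ
    simpa [ρ, r, div_eq_mul_inv] using this
  have hconv {f : Rn n → ℝ} (hf : LocallyIntegrable f) : ∀ᵐ x,
      Filter.Tendsto (fun k => mollify (ρ k) f x) Filter.atTop (nhds (f x)) := by
    have := ContDiffBump.ae_convolution_tendsto_right_of_locallyIntegrable (K := 2) hρ0
      (.of_forall fun k => by simp only [ρ]; linarith) hf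
    simpa only [convolution_normed_eq_mollify] using this
  let u : Rn n → ℝ := fun x => f₁ x * φ x
  have hum : Measurable u := hf₁.mul hφ.continuous.measurable
  have hui : Integrable u := (hφ.continuous.integrable_of_hasCompactSupport hφ.2.1).bdd_mul
    hf₁.aestronglyMeasurable (.of_forall hB₁)
  have hub : ∀ x, |u x| ≤ B₁ * M := fun x => by
    rw [abs_mul]
    exact mul_le_mul (hB₁ x) (hM x) (abs_nonneg _) hB₁0
  have hf₂i := locallyIntegrable_of_bound hf₂ hB₂
  have htestF (k : ℕ) : IsTest U fun x => mollify (ρ k) f₂ x * φ x :=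
    ⟨(contDiff_mollify _ hf₂i).mul hφ.1, hφ.2.1.mul_left,
      (tsupport_mul_subset_right).trans hφ.2.2⟩
  have htestu (k : ℕ) : IsTest U (mollify (ρ k) u) := by
    have hsub := tsupport_mollify_subset (ρ k) (f := u) hφ.2.1.isCompact fun x hx => by
      simp [u, image_eq_zero_of_notMem_tsupport hx]
    refine ⟨contDiff_mollify _ hui.locallyIntegrable, ?_, ?_⟩
    · exact (hφ.2.1.isCompact.cthickening).of_isClosed_subset (isClosed_tsupport _) hsub
    · exact hsub.trans ((Metric.cthickening_mono (hrδ k) _).trans hδU)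
  have key (k : ℕ) : (∫ x in U, f₁ x * mollify (ρ k) f₂ x * pd j φ x) +
      ∫ x in U, h₂ x * mollify (ρ k) u x = -∫ x in U, h₁ x * (mollify (ρ k) f₂ x * φ x) := by
    have hFd := (contDiff_mollify (ρ k) hf₂i)
    have hFd1 : ContDiff ℝ 1 (mollify (ρ k) f₂) := hFd.of_le (by exact_mod_cast le_top)
    have hsupp {v : Rn n → ℝ} (hv : ∀ x ∉ U, v x = 0) : ∫ x in U, v x = ∫ x, v x :=
      setIntegral_eq_integral_of_forall_compl_eq_zero hv
    have e1 : ∫ x in U, u x * pd j (mollify (ρ k) f₂) x = ∫ x in U, h₂ x * mollify (ρ k) u x := by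
      rw [hsupp fun x hx => ?_, integral_mul_pd_mollify _ hui hf₂ hB₂, ← hsupp fun x hx => ?_,
        hw₂ _ (htestu k), neg_neg]
      · rw [pd_eq_zero_of_notMem_tsupport (fun h => hx ((htestu k).2.2 h)), mul_zero]
      · simp [u, image_eq_zero_of_notMem_tsupport fun h => hx (hφ.2.2 h)]
    rw [← hw₁ _ (htestF k), ← e1, ← integral_add]
    · refine integral_congr_ae (.of_forall fun x => ?_)
      simp only
      rw [pd_mul (hFd1.differentiable one_ne_zero x)
        (hφ.contDiff_one.differentiable one_ne_zero x)]
      simp only [u]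
      ring
    · refine hφ.integrable_mul_pd (B := B₁ * B₂)
        (hf₁.mul hFd.continuous.measurable).aestronglyMeasurable (fun x => ?_) j
      rw [Pi.mul_apply, abs_mul]
      exact mul_le_mul (hB₁ x) (abs_mollify_le _ hB₂ x) (abs_nonneg _) hB₁0
    · have hc : Integrable fun x => φ x * pd j (mollify (ρ k) f₂) x :=
        (hφ.continuous.mul (continuous_pd hFd1 j)).integrable_of_hasCompactSupport
          hφ.2.1.mul_right
      have := (hc.bdd_mul hf₁.aestronglyMeasurable (.of_forall hB₁)).integrableOn (s := U)
      refine this.congr (.of_forall fun x => ?_)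
      simp only [u]
      ring
  have t1 : Filter.Tendsto (fun k => ∫ x in U, f₁ x * mollify (ρ k) f₂ x * pd j φ x)
      Filter.atTop (nhds (∫ x in U, f₁ x * f₂ x * pd j φ x)) := by
    have hi : IntegrableOn (pd j φ) U := (hφ.integrable_pd j).integrableOn
    refine tendsto_integral_of_dominated_convergence (fun x => B₁ * B₂ * |pd j φ x|)
      (fun k => ?_) (hi.norm.const_mul _) (fun k => .of_forall fun x => ?_) ?_
    · exact ((hf₁.mul (contDiff_mollify _ hf₂i).continuous.measurable).mul
        (continuous_pd hφ.contDiff_one j).measurable).aestronglyMeasurable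
    · rw [Real.norm_eq_abs, abs_mul, abs_mul]
      gcongr
      exacts [hB₁ x, abs_mollify_le _ hB₂ x]
    · filter_upwards [ae_restrict_of_ae (hconv hf₂i)] with x hx
      exact (hx.const_mul _).mul_const _
  have t2 : Filter.Tendsto (fun k => ∫ x in U, h₂ x * mollify (ρ k) u x)
      Filter.atTop (nhds (∫ x in U, h₂ x * u x)) := by
    refine tendsto_integral_of_dominated_convergence (fun x => |h₂ x| * (B₁ * M))
      (fun k => ?_) (hh₂.norm.mul_const _) (fun k => .of_forall fun x => ?_) ?_
    · exact hh₂.aestronglyMeasurable.mul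
        (contDiff_mollify _ hui.locallyIntegrable).continuous.aestronglyMeasurable
    · rw [Real.norm_eq_abs, abs_mul]
      gcongr
      exact abs_mollify_le _ hub x
    · filter_upwards [ae_restrict_of_ae (hconv hui.locallyIntegrable)] with x hx
      exact hx.const_mul _
  have t3 : Filter.Tendsto (fun k => ∫ x in U, h₁ x * (mollify (ρ k) f₂ x * φ x))
      Filter.atTop (nhds (∫ x in U, h₁ x * (f₂ x * φ x))) := by
    refine tendsto_integral_of_dominated_convergence (fun x => |h₁ x| * (B₂ * M))
      (fun k => ?_) (hh₁.norm.mul_const _) (fun k => .of_forall fun x => ?_) ?_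
    · exact hh₁.aestronglyMeasurable.mul (htestF k).continuous.aestronglyMeasurable
    · rw [Real.norm_eq_abs, abs_mul, abs_mul]
      gcongr
      exacts [abs_mollify_le _ hB₂ x, hM x]
    · filter_upwards [ae_restrict_of_ae (hconv hf₂i)] with x hx
      exact (hx.mul_const _).const_mul _
  have hlim := tendsto_nhds_unique ((t1.add t2).congr key) t3.neg
  have hi1 : IntegrableOn (fun x => h₁ x * (f₂ x * φ x)) U := by
    refine (Integrable.mul_bdd (c := B₂) (hφ.integrable_mul hh₁) hf₂.aestronglyMeasurable
      (.of_forall hB₂)).congr (.of_forall fun x => ?_)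
    simp only
    ring
  have hi2 : IntegrableOn (fun x => h₂ x * u x) U :=
    Integrable.mul_bdd hh₂ hum.aestronglyMeasurable (.of_forall hub)
  have hsplit : ∫ x in U, (h₁ x * f₂ x + f₁ x * h₂ x) * φ x =
      (∫ x in U, h₁ x * (f₂ x * φ x)) + ∫ x in U, h₂ x * u x := by
    rw [← integral_add hi1 hi2]
    refine integral_congr_ae (.of_forall fun x => ?_)
    simp only [u]
    ring
  rw [hsplit]
  linarith
/-- A weak derivative, in a sense not requiring measurability, which has finite `L^p` norm can be
replaced by an integrable one that is pointwise no larger. -/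
lemma HasWeakPD.exists_integrableOn {n : ℕ} {U : Set (Rn n)} (hU : IsOpen U)
    (hUb : Bornology.IsBounded U) {f h : Rn n → ℝ} {B : ℝ} {j : Fin n} {p : ℝ≥0∞} (hp : 1 ≤ p)
    (hf : Measurable f) (hB : ∀ x, |f x| ≤ B) (hw : HasWeakPD U f h j)
    (hh : eLpNorm h p (volume.restrict U) ≠ ⊤) :
    ∃ h' : Rn n → ℝ, IntegrableOn h' U ∧ HasWeakPD U f h' j ∧ ∀ x, |h' x| ≤ |h x| := by
  by_cases hI : ∀ φ, IsTest U φ → IntegrableOn (fun x => h x * φ x) U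
  · refine ⟨h, ?_, hw, fun x => le_rfl⟩
    have hloc : LocallyIntegrableOn h U := by
      intro x hx
      obtain ⟨ε, hε, hεU⟩ := Metric.nhds_basis_closedBall.mem_iff.mp (hU.mem_nhds hx)
      let ψ : ContDiffBump x := ⟨ε / 2, ε, by linarith, by linarith⟩
      have hψ : IsTest U ψ := ⟨ψ.contDiff, ψ.hasCompactSupport, by rwa [ψ.tsupport_eq]⟩
      refine ⟨U ∩ Metric.ball x (ε / 2),
        inter_mem_nhdsWithin _ (Metric.ball_mem_nhds _ (by linarith)),
        ((hI ψ hψ).mono_set Set.inter_subset_left).congr_fun (fun y hy => ?_)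
          (hU.measurableSet.inter Metric.isOpen_ball.measurableSet)⟩
      simp only
      rw [ψ.one_of_mem_closedBall (Metric.ball_subset_closedBall hy.2), mul_one]
    have : IsFiniteMeasure (volume.restrict U) := ⟨by
      simpa using hUb.measure_lt_top⟩
    exact MemLp.integrable hp ⟨hloc.aestronglyMeasurable, hh.lt_top⟩
  · push Not at hI
    obtain ⟨φ₀, hφ₀, hn⟩ := hI
    refine ⟨0, integrableOn_zero, fun φ hφ => ?_, fun x => by simp⟩
    have hzero {χ : Rn n → ℝ} (hχ : IsTest U χ) (hnχ : ¬ IntegrableOn (fun x => h x * χ x) U) :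
        ∫ x in U, f x * pd j χ x = 0 := by
      rw [hw χ hχ, integral_undef hnχ, neg_zero]
    simp only [Pi.zero_apply, zero_mul, integral_zero, neg_zero]
    by_cases hφi : IntegrableOn (fun x => h x * φ x) U
    · have hadd : IsTest U fun x => φ x + φ₀ x :=
        ⟨hφ.1.add hφ₀.1, hφ.2.1.add hφ₀.2.1,
          (tsupport_add φ φ₀).trans (Set.union_subset hφ.2.2 hφ₀.2.2)⟩
      have hnadd : ¬ IntegrableOn (fun x => h x * (φ x + φ₀ x)) U := fun hi => hn <| by
        refine (hi.sub hφi).congr (.of_forall fun x => ?_)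
        simp only [Pi.sub_apply]
        ring
      have hpd (x : Rn n) : pd j (fun y => φ y + φ₀ y) x = pd j φ x + pd j φ₀ x := by
        rw [pd, fderiv_fun_add (hφ.contDiff_one.differentiable one_ne_zero x)
          (hφ₀.contDiff_one.differentiable one_ne_zero x)]
        rfl
      have h0 := hzero hadd hnadd
      simp_rw [hpd, mul_add] at h0
      rwa [integral_add (hφ.integrable_mul_pd hf.aestronglyMeasurable hB j)
        (hφ₀.integrable_mul_pd hf.aestronglyMeasurable hB j), hzero hφ₀ hn, add_zero] at h0
    · exact hzero hφ hφi

/-- `f` is a bounded measurable function with integrable weak `j`-th derivative `h` on `U`. -/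
structure IsBoundedWeak {n : ℕ} (U : Set (Rn n)) (f h : Rn n → ℝ) (j : Fin n) : Prop where
  measurable : Measurable f
  bounded : ∃ B, ∀ x, |f x| ≤ B
  integrableOn : IntegrableOn h U
  hasWeakPD : HasWeakPD U f h j

namespace IsBoundedWeak

variable {n : ℕ} {U : Set (Rn n)} {f g h k : Rn n → ℝ} {j : Fin n}

protected lemma const (c : ℝ) : IsBoundedWeak U (fun _ => c) (fun _ => 0) j where
  measurable := measurable_const
  bounded := ⟨|c|, fun _ => le_rfl⟩
  integrableOn := integrableOn_zero
  hasWeakPD φ hφ := by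
    have hi := hφ.integrable_pd j
    have hφi : Integrable φ := hφ.continuous.integrable_of_hasCompactSupport hφ.2.1
    rw [setIntegral_eq_integral_of_forall_compl_eq_zero fun x hx => by
      rw [pd_eq_zero_of_notMem_tsupport fun h => hx (hφ.2.2 h), mul_zero]]
    have := integral_mul_fderiv_eq_neg_fderiv_mul_of_integrable (μ := volume)
      (f := fun _ : Rn n => c) (g := φ) (v := Pi.single j 1) (by simp) (hi.const_mul c)
      (hφi.const_mul c) (fun _ _ => differentiableAt_const _)
      (fun x _ => hφ.contDiff_one.differentiable one_ne_zero x)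
    simpa [pd] using this

protected lemma add (hf : IsBoundedWeak U f h j) (hg : IsBoundedWeak U g k j) :
    IsBoundedWeak U (fun x => f x + g x) (fun x => h x + k x) j where
  measurable := hf.measurable.add hg.measurable
  bounded := by
    obtain ⟨B, hB⟩ := hf.bounded
    obtain ⟨D, hD⟩ := hg.bounded
    exact ⟨B + D, fun x => (abs_add_le _ _).trans (add_le_add (hB x) (hD x))⟩
  integrableOn := hf.integrableOn.add hg.integrableOn
  hasWeakPD φ hφ := by
    obtain ⟨B, hB⟩ := hf.bounded
    obtain ⟨D, hD⟩ := hg.bounded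
    simp_rw [add_mul]
    rw [integral_add (hφ.integrable_mul_pd hf.measurable.aestronglyMeasurable hB j)
        (hφ.integrable_mul_pd hg.measurable.aestronglyMeasurable hD j),
      integral_add (hφ.integrable_mul hf.integrableOn) (hφ.integrable_mul hg.integrableOn),
      hf.hasWeakPD φ hφ, hg.hasWeakPD φ hφ, neg_add]

protected lemma mul (hU : IsOpen U) (hf : IsBoundedWeak U f h j) (hg : IsBoundedWeak U g k j) :
    IsBoundedWeak U (fun x => f x * g x) (fun x => h x * g x + f x * k x) j := by
  obtain ⟨B, hB⟩ := hf.bounded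
  obtain ⟨D, hD⟩ := hg.bounded
  refine ⟨hf.measurable.mul hg.measurable, ⟨B * D, fun x => ?_⟩, ?_,
    HasWeakPD.mul hU hf.measurable hg.measurable hB hD hf.integrableOn hg.integrableOn
      hf.hasWeakPD hg.hasWeakPD⟩
  · rw [abs_mul]
    exact mul_le_mul (hB x) (hD x) (abs_nonneg _) ((abs_nonneg _).trans (hB x))
  · exact (Integrable.mul_bdd hf.integrableOn hg.measurable.aestronglyMeasurable
      (.of_forall hD)).add
      (Integrable.bdd_mul hg.integrableOn hf.measurable.aestronglyMeasurable (.of_forall hB))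

protected lemma const_mul (hU : IsOpen U) (c : ℝ) (hf : IsBoundedWeak U f h j) :
    IsBoundedWeak U (fun x => c * f x) (fun x => c * h x) j := by
  simpa using (IsBoundedWeak.const c).mul hU hf

protected lemma sum {ι : Type*} (s : Finset ι) {F H : ι → Rn n → ℝ}
    (hF : ∀ i ∈ s, IsBoundedWeak U (F i) (H i) j) :
    IsBoundedWeak U (fun x => ∑ i ∈ s, F i x) (fun x => ∑ i ∈ s, H i x) j := by
  classical
  induction s using Finset.induction_on with
  | empty => simpa using IsBoundedWeak.const (U := U) (j := j) 0
  | insert a s ha ih =>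
    simp only [Finset.sum_insert ha]
    exact (hF a (Finset.mem_insert_self a s)).add
      (ih fun i hi => hF i (Finset.mem_insert_of_mem hi))

lemma of_tendsto {F H : ℕ → Rn n → ℝ} {B : ℝ} {G : Rn n → ℝ}
    (hF : ∀ m, IsBoundedWeak U (F m) (H m) j) (hB : ∀ m x, |F m x| ≤ B)
    (hG : IntegrableOn G U) (hHG : ∀ m x, |H m x| ≤ G x)
    (hFf : ∀ x, Filter.Tendsto (fun m => F m x) Filter.atTop (nhds (f x)))
    (hHh : ∀ x, Filter.Tendsto (fun m => H m x) Filter.atTop (nhds (h x))) :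
    IsBoundedWeak U f h j where
  measurable := measurable_of_tendsto_metrizable (fun m => (hF m).measurable)
    (tendsto_pi_nhds.mpr hFf)
  bounded := ⟨B, fun x => le_of_tendsto (hFf x).abs (.of_forall fun m => hB m x)⟩
  integrableOn := hG.mono'
    (aestronglyMeasurable_of_tendsto_ae _ (fun m => (hF m).integrableOn.aestronglyMeasurable)
      (.of_forall hHh))
    (.of_forall fun x => le_of_tendsto (hHh x).abs (.of_forall fun m => hHG m x))
  hasWeakPD φ hφ := by
    obtain ⟨M, hM⟩ := hφ.exists_bound
    have hpi : IntegrableOn (pd j φ) U := (hφ.integrable_pd j).integrableOn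
    have hleft : Filter.Tendsto (fun m => ∫ x in U, F m x * pd j φ x) Filter.atTop
        (nhds (∫ x in U, f x * pd j φ x)) := by
      refine tendsto_integral_of_dominated_convergence (fun x => B * |pd j φ x|)
        (fun m => ?_) (hpi.norm.const_mul _) (fun m => .of_forall fun x => ?_)
        (.of_forall fun x => (hFf x).mul_const _)
      · exact (hF m).measurable.aestronglyMeasurable.mul hpi.aestronglyMeasurable
      · rw [Real.norm_eq_abs, abs_mul]
        gcongr
        exact hB m x
    have hright : Filter.Tendsto (fun m => ∫ x in U, H m x * φ x) Filter.atTop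
        (nhds (∫ x in U, h x * φ x)) := by
      refine tendsto_integral_of_dominated_convergence (fun x => G x * M)
        (fun m => ?_) (hG.mul_const _) (fun m => .of_forall fun x => ?_)
        (.of_forall fun x => (hHh x).mul_const _)
      · exact (hφ.integrable_mul (hF m).integrableOn).aestronglyMeasurable
      · rw [Real.norm_eq_abs, abs_mul]
        exact mul_le_mul (hHG m x) (hM x) (abs_nonneg _) ((abs_nonneg _).trans (hHG m x))
    exact tendsto_nhds_unique (hleft.congr fun m => (hF m).hasWeakPD φ hφ) hright.neg

end IsBoundedWeak

section MatrixField

variable {n : ℕ} {U : Set (Rn n)} {A H : Rn n → Matrix (Fin n) (Fin n) ℝ} {j : Fin n} {q : ℝ}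

lemma abs_entry_le_norm (M : Matrix (Fin n) (Fin n) ℝ) (a b : Fin n) : |M a b| ≤ ‖M‖ := by
  refine abs_le_of_sq_le_sq ?_ (norm_nonneg _)
  rw [frobenius_norm_sq]
  exact (Finset.single_le_sum (f := fun c => M a c ^ 2) (fun c _ => sq_nonneg _)
    (Finset.mem_univ b)).trans (Finset.single_le_sum (f := fun d => ∑ c, M d c ^ 2)
    (fun d _ => Finset.sum_nonneg fun c _ => sq_nonneg _) (Finset.mem_univ a))

lemma norm_le_sum_abs (M : Matrix (Fin n) (Fin n) ℝ) : ‖M‖ ≤ ∑ a, ∑ b, |M a b| := by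
  refine le_of_sq_le_sq ?_ (by positivity)
  rw [frobenius_norm_sq]
  calc ∑ a, ∑ b, M a b ^ 2 = ∑ a, ∑ b, |M a b| ^ 2 := by simp only [sq_abs]
    _ ≤ ∑ a, (∑ b, |M a b|) ^ 2 := Finset.sum_le_sum fun a _ =>
        Finset.sum_sq_le_sq_sum_of_nonneg fun b _ => abs_nonneg _
    _ ≤ _ := Finset.sum_sq_le_sq_sum_of_nonneg fun a _ =>
        Finset.sum_nonneg fun b _ => abs_nonneg _

lemma isBoundedWeak_pow (hU : IsOpen U)
    (hA : ∀ a b, IsBoundedWeak U (fun x => A x a b) (fun x => H x a b) j) (m : ℕ) (a b : Fin n) :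
    IsBoundedWeak U (fun x => (A x ^ m) a b) (fun x => powDeriv (A x) (H x) m a b) j := by
  induction m generalizing a b with
  | zero => simpa [powDeriv] using IsBoundedWeak.const ((1 : Matrix (Fin n) (Fin n) ℝ) a b)
  | succ m ih =>
    simp only [pow_succ, powDeriv, Matrix.add_apply, Matrix.mul_apply,
      ← Finset.sum_add_distrib]
    exact IsBoundedWeak.sum _ fun c _ => (ih a c).mul hU (hA c b)

lemma isBoundedWeak_invSqrtSeries (hU : IsOpen U) (hq : 0 ≤ q) (hq1 : q < 1)
    (hA : ∀ a b, IsBoundedWeak U (fun x => A x a b) (fun x => H x a b) j)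
    (hop : ∀ x, OpBound (A x) q) (a b : Fin n) :
    IsBoundedWeak U (fun x => invSqrtSeries (A x) a b)
      (fun x => invSqrtSeriesDeriv (A x) (H x) a b) j := by
  have hgeom := (summable_geometric_of_lt_one hq hq1).mul_right
    ‖(1 : Matrix (Fin n) (Fin n) ℝ)‖
  have hpow := summable_nat_mul_pow_pred hq hq1
  have entry {v : ℕ → Matrix (Fin n) (Fin n) ℝ} (hv : Summable fun m => ‖v m‖) :
      Filter.Tendsto (fun M => ∑ m ∈ Finset.range M, v m a b) Filter.atTop
        (nhds ((∑' m, v m) a b)) := by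
    have h1 := hv.of_norm.hasSum.tendsto_sum_nat
    have h2 : Continuous fun M : Matrix (Fin n) (Fin n) ℝ => M a b :=
      continuous_id.matrix_elem a b
    refine ((h2.tendsto _).comp h1).congr fun M => ?_
    exact Matrix.sum_apply a b _ _
  refine IsBoundedWeak.of_tendsto
    (F := fun M x => ∑ m ∈ Finset.range M, (invSqrtCoeff m • A x ^ m) a b)
    (H := fun M x => ∑ m ∈ Finset.range M, (invSqrtCoeff m • powDeriv (A x) (H x) m) a b)
    (B := ∑' m, q ^ m * ‖(1 : Matrix (Fin n) (Fin n) ℝ)‖)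
    (G := fun x => (∑' m : ℕ, (m : ℝ) * q ^ (m - 1)) * ∑ c, ∑ d, |H x c d|)
    (fun M => ?_) (fun M x => ?_) ?_ (fun M x => ?_)
    (fun x => entry ((hop x).summable_norm hq hq1))
    (fun x => entry ((hop x).summable_deriv_norm hq hq1 (H x)))
  · exact IsBoundedWeak.sum _ fun m _ => (isBoundedWeak_pow hU hA m a b).const_mul hU _
  · refine (Finset.abs_sum_le_sum_abs _ _).trans ((Finset.sum_le_sum fun m _ => ?_).trans
      (hgeom.sum_le_tsum (Finset.range M) fun m _ => by positivity))
    exact (abs_entry_le_norm _ a b).trans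
      ((norm_invSqrtCoeff_smul_le m _).trans ((hop x).norm_pow_le hq m))
  · exact (integrable_finsetSum _ fun c _ => integrable_finsetSum _ fun d _ =>
      (hA c d).integrableOn.norm).const_mul _
  · have hterm (m : ℕ) : |(invSqrtCoeff m • powDeriv (A x) (H x) m) a b| ≤
        m * q ^ (m - 1) * ∑ c, ∑ d, |H x c d| :=
      (abs_entry_le_norm _ a b).trans ((norm_invSqrtCoeff_smul_le m _).trans
        (((hop x).norm_powDeriv_le hq (H x) m).trans
          (mul_le_mul_of_nonneg_left (norm_le_sum_abs _) (by positivity))))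
    refine (Finset.abs_sum_le_sum_abs _ _).trans
      ((Finset.sum_le_sum fun m _ => hterm m).trans ?_)
    rw [← Finset.sum_mul]
    exact mul_le_mul_of_nonneg_right
      (hpow.sum_le_tsum (Finset.range M) fun m _ => by positivity) (by positivity)

end MatrixField

section Frame

variable {n : ℕ} {Λ : ℝ} {M : Matrix (Fin n) (Fin n) ℝ}

lemma HasWeakPD.congr_ae {U : Set (Rn n)} {f f' h : Rn n → ℝ} {j : Fin n}
    (hf : HasWeakPD U f h j) (hff' : f =ᵐ[volume.restrict U] f') : HasWeakPD U f' h j := by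
  intro φ hφ
  rw [← hf φ hφ]
  refine integral_congr_ae ?_
  filter_upwards [hff'] with x hx
  rw [hx]

/-- `M` is symmetric with all eigenvalues in `[Λ⁻¹, Λ]`. -/
def IsElliptic (Λ : ℝ) (M : Matrix (Fin n) (Fin n) ℝ) : Prop :=
  M.IsSymm ∧ ∀ v : Fin n → ℝ,
    Λ⁻¹ * (v ⬝ᵥ v) ≤ v ⬝ᵥ M.mulVec v ∧ v ⬝ᵥ M.mulVec v ≤ Λ * (v ⬝ᵥ v)

lemma isElliptic_one (hΛ : 1 ≤ Λ) : IsElliptic Λ (1 : Matrix (Fin n) (Fin n) ℝ) := by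
  refine ⟨Matrix.isSymm_one, fun v => ?_⟩
  have hv : 0 ≤ v ⬝ᵥ v := Finset.sum_nonneg fun i _ => mul_self_nonneg (v i)
  rw [Matrix.one_mulVec]
  exact ⟨mul_le_of_le_one_left hv (inv_le_one_of_one_le₀ hΛ), le_mul_of_one_le_left hv hΛ⟩

/-- The contraction `A` for which `M = Λ (1 - A)`. -/
def contraction (Λ : ℝ) (M : Matrix (Fin n) (Fin n) ℝ) : Matrix (Fin n) (Fin n) ℝ :=
  1 - Λ⁻¹ • M

lemma contraction_rate (hΛ : 1 ≤ Λ) : 0 < 1 - Λ⁻¹ ^ 2 / 2 ∧ 1 - Λ⁻¹ ^ 2 / 2 < 1 := by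
  have h0 : 0 < Λ⁻¹ := by positivity
  have h1 : Λ⁻¹ ^ 2 ≤ 1 := pow_le_one₀ h0.le (inv_le_one_of_one_le₀ hΛ)
  have h2 : 0 < Λ⁻¹ ^ 2 := by positivity
  constructor <;> linarith

lemma IsElliptic.contraction_isSymm (hM : IsElliptic Λ M) : (contraction Λ M).IsSymm :=
  Matrix.isSymm_one.sub (hM.1.smul _)

lemma IsElliptic.opBound (hΛ : 1 ≤ Λ) (hM : IsElliptic Λ M) :
    OpBound (contraction Λ M) (1 - Λ⁻¹ ^ 2 / 2) := by
  refine OpBound.of_quadratic (contraction_rate hΛ).1 hM.contraction_isSymm fun v => ?_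
  have hΛ' : 0 < Λ := by linarith
  obtain ⟨h1, h2⟩ := hM.2 v
  have hv : 0 ≤ v ⬝ᵥ v := Finset.sum_nonneg fun i _ => mul_self_nonneg (v i)
  have h3 : v ⬝ᵥ (contraction Λ M).mulVec v = v ⬝ᵥ v - Λ⁻¹ * (v ⬝ᵥ M.mulVec v) := by
    rw [contraction, Matrix.sub_mulVec, Matrix.one_mulVec, Matrix.smul_mulVec, dotProduct_sub,
      dotProduct_smul, smul_eq_mul]
  have h4 : Λ⁻¹ * (v ⬝ᵥ M.mulVec v) ≤ v ⬝ᵥ v := (inv_mul_le_iff₀ hΛ').mpr h2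
  have h5 := mul_le_mul_of_nonneg_left h1 (inv_nonneg.mpr hΛ'.le)
  have h6 : 0 ≤ Λ⁻¹ ^ 2 * (v ⬝ᵥ v) := by positivity
  rw [h3]
  constructor <;> linarith

lemma IsElliptic.inv_smul_mul_mul (hΛ : 1 ≤ Λ) (hM : IsElliptic Λ M) :
    Λ⁻¹ • (invSqrtSeries (contraction Λ M) * M * invSqrtSeries (contraction Λ M)) = 1 := by
  have hS := commute_invSqrtSeries (contraction Λ M)
  have h := (hM.opBound hΛ).one_sub_mul_invSqrtSeries_sq (contraction_rate hΛ).1.le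
    (contraction_rate hΛ).2
  have hM' : 1 - contraction Λ M = Λ⁻¹ • M := sub_sub_cancel _ _
  have hc : Commute (invSqrtSeries (contraction Λ M)) (Λ⁻¹ • M) := by
    rw [← hM']
    exact (Commute.one_right _).sub_right hS.symm
  rw [hM', ← mul_assoc, ← hc.eq] at h
  rwa [mul_assoc, ← mul_smul_comm, ← smul_mul_assoc, ← mul_assoc]

/-- The `i`-th column of `M ^ (-1 / 2)`. -/
def frameVector (Λ : ℝ) (M : Matrix (Fin n) (Fin n) ℝ) (i a : Fin n) : ℝ :=
  (√Λ)⁻¹ * invSqrtSeries (contraction Λ M) a i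

lemma IsElliptic.sum_frameVector (hΛ : 1 ≤ Λ) (hM : IsElliptic Λ M) (i j : Fin n) :
    ∑ a, ∑ b, M a b * frameVector Λ M i a * frameVector Λ M j b = if i = j then 1 else 0 := by
  have hsq : (√Λ)⁻¹ * (√Λ)⁻¹ = Λ⁻¹ := by
    rw [← mul_inv, Real.mul_self_sqrt (by linarith)]
  have h := congrFun₂ (hM.inv_smul_mul_mul hΛ) i j
  rw [Matrix.one_apply] at h
  rw [← h, Matrix.smul_apply, Matrix.mul_apply, smul_eq_mul, Finset.mul_sum, Finset.sum_comm]
  refine Finset.sum_congr rfl fun b _ => ?_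
  rw [Matrix.mul_apply, Finset.sum_mul, Finset.mul_sum]
  refine Finset.sum_congr rfl fun a _ => ?_
  rw [← (invSqrtSeries_isSymm hM.contraction_isSymm).apply i a, frameVector, frameVector, ← hsq]
  ring

lemma IsElliptic.sqrt_sum_frameVector_sq_le (hΛ : 1 ≤ Λ) (hM : IsElliptic Λ M) (i : Fin n) :
    √(∑ a, frameVector Λ M i a ^ 2) ≤ Λ := by
  have hΛ' : 0 < Λ := by linarith
  have h1 := (hM.2 (frameVector Λ M i)).1
  have h2 : frameVector Λ M i ⬝ᵥ M.mulVec (frameVector Λ M i) = 1 := by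
    have := hM.sum_frameVector hΛ i i
    rw [if_pos rfl] at this
    rw [← this]
    simp only [dotProduct, Matrix.mulVec, Finset.mul_sum]
    exact Finset.sum_congr rfl fun a _ => Finset.sum_congr rfl fun b _ => by ring
  rw [h2, inv_mul_le_iff₀ hΛ', mul_one] at h1
  refine Real.sqrt_le_iff.mpr ⟨hΛ'.le, ?_⟩
  simp only [dotProduct, ← pow_two] at h1
  exact h1.trans (le_self_pow₀ hΛ two_ne_zero)

lemma sqrt_sum_frameDeriv_sq_le (hΛ : 1 ≤ Λ) (hM : IsElliptic Λ M)
    {B D : Fin n → Matrix (Fin n) (Fin n) ℝ} (hBD : ∀ k a b, |B k a b| ≤ |D k a b|) (i : Fin n) :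
    √(∑ k, ∑ a, ((√Λ)⁻¹ * invSqrtSeriesDeriv (contraction Λ M) (-Λ⁻¹ • B k) a i) ^ 2) ≤
      (∑' m : ℕ, (m : ℝ) * (1 - Λ⁻¹ ^ 2 / 2) ^ (m - 1)) * √(∑ k, ∑ a, ∑ b, D k a b ^ 2) := by
  obtain ⟨hq, hq1⟩ := contraction_rate hΛ
  set K := ∑' m : ℕ, (m : ℝ) * (1 - Λ⁻¹ ^ 2 / 2) ^ (m - 1)
  have hK : 0 ≤ K := tsum_nonneg fun m => by positivity
  have hΛ1 : Λ⁻¹ ≤ 1 := inv_le_one_of_one_le₀ hΛ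
  have hΛ0 : 0 ≤ Λ⁻¹ := by positivity
  have hr : (√Λ)⁻¹ ^ 2 ≤ 1 := by
    rw [inv_pow, Real.sq_sqrt (by linarith)]
    exact hΛ1
  refine Real.sqrt_le_iff.mpr ⟨by positivity, ?_⟩
  rw [mul_pow, Real.sq_sqrt (by positivity), Finset.mul_sum]
  refine Finset.sum_le_sum fun k _ => ?_
  set S := invSqrtSeriesDeriv (contraction Λ M) (-Λ⁻¹ • B k)
  calc ∑ a, ((√Λ)⁻¹ * S a i) ^ 2 ≤ ∑ a, ∑ b, S a b ^ 2 := by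
        refine Finset.sum_le_sum fun a _ => ?_
        rw [mul_pow]
        exact (mul_le_of_le_one_left (sq_nonneg _) hr).trans
          (Finset.single_le_sum (f := fun b => S a b ^ 2) (fun b _ => sq_nonneg _)
            (Finset.mem_univ i))
    _ = ‖S‖ ^ 2 := (frobenius_norm_sq S).symm
    _ ≤ (K * ‖-Λ⁻¹ • B k‖) ^ 2 := by
        gcongr
        exact (hM.opBound hΛ).norm_invSqrtSeriesDeriv_le hq.le hq1 _
    _ ≤ (K * ‖B k‖) ^ 2 := by
        gcongr
        rw [norm_smul, norm_neg, Real.norm_of_nonneg hΛ0]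
        exact mul_le_of_le_one_left (norm_nonneg _) hΛ1
    _ = K ^ 2 * ∑ a, ∑ b, B k a b ^ 2 := by rw [mul_pow, frobenius_norm_sq]
    _ ≤ K ^ 2 * ∑ a, ∑ b, D k a b ^ 2 := by
        gcongr K ^ 2 * ∑ a, ∑ b, ?_ with a _ b _
        exact sq_le_sq.mpr (hBD k a b)

lemma IsElliptic.abs_apply_le (hΛ : 1 ≤ Λ) (hM : IsElliptic Λ M) (a b : Fin n) :
    |M a b| ≤ Λ * (2 * ‖(1 : Matrix (Fin n) (Fin n) ℝ)‖) := by
  have hM' : M = Λ • (1 - contraction Λ M) := by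
    have h : 1 - contraction Λ M = Λ⁻¹ • M := sub_sub_cancel _ _
    rw [h, smul_inv_smul₀ (by linarith)]
  have h1 : ‖contraction Λ M‖ ≤ ‖(1 : Matrix (Fin n) (Fin n) ℝ)‖ := by
    have h := (hM.opBound hΛ 1).1
    rw [mul_one] at h
    exact h.trans (mul_le_of_le_one_left (norm_nonneg _) (contraction_rate hΛ).2.le)
  refine (abs_entry_le_norm M a b).trans ?_
  rw [hM', norm_smul, Real.norm_of_nonneg (by linarith)]
  gcongr
  exact (norm_sub_le _ _).trans (by linarith)

lemma isElliptic_of_sum (hM : ∀ i j, M i j = M j i)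
    (h : ∀ ξ : Fin n → ℝ, Λ⁻¹ * ∑ i, ξ i ^ 2 ≤ (∑ i, ∑ j, M i j * ξ i * ξ j) ∧
      (∑ i, ∑ j, M i j * ξ i * ξ j) ≤ Λ * ∑ i, ξ i ^ 2) : IsElliptic Λ M := by
  refine ⟨Matrix.IsSymm.ext fun i j => hM j i, fun v => ?_⟩
  have h1 : v ⬝ᵥ v = ∑ i, v i ^ 2 := by simp only [dotProduct, pow_two]
  have h2 : v ⬝ᵥ M.mulVec v = ∑ i, ∑ j, M i j * v i * v j := by
    simp only [dotProduct, Matrix.mulVec, Finset.mul_sum]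
    exact Finset.sum_congr rfl fun a _ => Finset.sum_congr rfl fun b _ => by ring
  rw [h1, h2]
  exact h v

/-- A matrix field that is elliptic almost everywhere agrees almost everywhere with one that is
elliptic everywhere. -/
lemma exists_isElliptic_ae_eq (hΛ : 1 ≤ Λ) {μ : Measure (Rn n)}
    {g : Rn n → Matrix (Fin n) (Fin n) ℝ} (hg : ∀ i j, Measurable fun x => g x i j)
    (hell : ∀ᵐ x ∂μ, IsElliptic Λ (g x)) :
    ∃ g' : Rn n → Matrix (Fin n) (Fin n) ℝ, (∀ i j, Measurable fun x => g' x i j) ∧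
      (∀ x, IsElliptic Λ (g' x)) ∧ g =ᵐ[μ] g' := by
  classical
  set N := toMeasurable μ {x | ¬ IsElliptic Λ (g x)}
  have hN : ∀ᵐ x ∂μ, x ∉ N := by
    rw [← measure_eq_zero_iff_ae_notMem, measure_toMeasurable]
    exact hell
  refine ⟨fun x => if x ∈ N then 1 else g x, fun i j => ?_, fun x => ?_, ?_⟩
  · have h : (fun x => (if x ∈ N then 1 else g x) i j) =
        fun x => if x ∈ N then (1 : Matrix (Fin n) (Fin n) ℝ) i j else g x i j := by
      ext x
      split_ifs <;> rfl
    rw [h]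
    exact Measurable.ite (measurableSet_toMeasurable _ _) measurable_const (hg i j)
  · dsimp only
    split_ifs with hx
    · exact isElliptic_one hΛ
    · by_contra hne
      exact hx (subset_toMeasurable _ _ hne)
  · filter_upwards [hN] with x hx
    rw [if_neg hx]

end Frame

/- STATEMENT 9: Gram–Schmidt orthonormal frames for a uniformly elliptic metric
`g ∈ L^∞ ∩ W^{1,n}`: there exist measurable vector fields `e₁,…,e_n` that are
`g`-orthonormal a.e. on `U`, with `|e_i| ≤ C(Λ)` and `|∇e_i| ≤ C(Λ)|∇g|` a.e.
(in particular `e_i ∈ L^∞ ∩ W^{1,n}(U,ℝⁿ)`). -/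
theorem gram_schmidt_frame (Λ : ℝ) (hΛ : 1 ≤ Λ) :
    ∃ C : ℝ, 0 < C ∧
      ∀ (n : ℕ), 2 ≤ n →
      ∀ (U : Set (Rn n)), IsOpen U → Bornology.IsBounded U →
      ∀ (g : Rn n → Matrix (Fin n) (Fin n) ℝ),
        (∀ i j, Measurable fun x => g x i j) →
        (∀ᵐ x ∂(volume.restrict U), ∀ i j, g x i j = g x j i) →
        (∀ᵐ x ∂(volume.restrict U), ∀ ξ : Rn n,
          Λ⁻¹ * ∑ i, ξ i ^ 2 ≤ (∑ i, ∑ j, g x i j * ξ i * ξ j) ∧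
            (∑ i, ∑ j, g x i j * ξ i * ξ j) ≤ Λ * ∑ i, ξ i ^ 2) →
      ∀ (Dg : Fin n → Rn n → Matrix (Fin n) (Fin n) ℝ),
        (∀ k i j, HasWeakPD U (fun x => g x i j) (fun x => Dg k x i j) k) →
        (∀ k i j, eLpNorm (fun x => Dg k x i j) n (volume.restrict U) ≠ ⊤) →
      ∃ (e : Fin n → Rn n → Rn n) (De : Fin n → Fin n → Rn n → Rn n),
        (∀ i a, Measurable fun x => e i x a) ∧
        (∀ k i a, HasWeakPD U (fun x => e i x a) (fun x => De k i x a) k) ∧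
        (∀ᵐ x ∂(volume.restrict U),
          (∀ i j, ∑ a, ∑ b, g x a b * e i x a * e j x b = if i = j then 1 else 0) ∧
          (∀ i, Real.sqrt (∑ a, e i x a ^ 2) ≤ C) ∧
          (∀ i, Real.sqrt (∑ k, ∑ a, De k i x a ^ 2) ≤
            C * Real.sqrt (∑ k, ∑ a, ∑ b, Dg k x a b ^ 2))) := by
  refine ⟨(∑' m : ℕ, (m : ℝ) * (1 - Λ⁻¹ ^ 2 / 2) ^ (m - 1)) + Λ, ?_, ?_⟩
  · have := (contraction_rate hΛ).1
    positivity
  intro n hn U hU hUb g hg hsymm hell Dg hDg hDgp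
  obtain ⟨hq, hq1⟩ := contraction_rate hΛ
  obtain ⟨g', hg', hell', hgg'⟩ := exists_isElliptic_ae_eq hΛ hg
    ((hsymm.and hell).mono fun x hx => isElliptic_of_sum hx.1 hx.2)
  have hw (k i j) : HasWeakPD U (fun x => g' x i j) (fun x => Dg k x i j) k :=
    (hDg k i j).congr_ae (hgg'.mono fun x hx => congrFun₂ hx i j)
  have hp : (1 : ℝ≥0∞) ≤ n := by exact_mod_cast (by lia : 1 ≤ n)
  choose D hDi hDw hDle using fun k i j => (hw k i j).exists_integrableOn hU hUb hp (hg' i j)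
    (fun x => (hell' x).abs_apply_le hΛ i j) (hDgp k i j)
  let B (k : Fin n) (x : Rn n) : Matrix (Fin n) (Fin n) ℝ := fun i j => D k i j x
  have hA (k i j) : IsBoundedWeak U (fun x => contraction Λ (g' x) i j)
      (fun x => (-Λ⁻¹ • B k x) i j) k := by
    have hgw : IsBoundedWeak U (fun x => g' x i j) (D k i j) k :=
      ⟨hg' i j, ⟨_, fun x => (hell' x).abs_apply_le hΛ i j⟩, hDi k i j, hDw k i j⟩
    have h := (IsBoundedWeak.const ((1 : Matrix (Fin n) (Fin n) ℝ) i j)).add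
      (hgw.const_mul hU (-Λ⁻¹))
    convert h using 2 with x x
    · rw [contraction, Matrix.sub_apply, Matrix.smul_apply, smul_eq_mul]
      ring
    · rw [zero_add]
      rfl
  have he (k i a) := (isBoundedWeak_invSqrtSeries hU hq.le hq1 (hA k)
    (fun x => (hell' x).opBound hΛ) a i).const_mul hU (√Λ)⁻¹
  refine ⟨fun i x => frameVector Λ (g' x) i,
    fun k i x a => (√Λ)⁻¹ * invSqrtSeriesDeriv (contraction Λ (g' x)) (-Λ⁻¹ • B k x) a i,
    fun i a => (he i i a).measurable, fun k i a => (he k i a).hasWeakPD, ?_⟩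
  filter_upwards [hgg'] with x hx
  have hK : 0 ≤ ∑' m : ℕ, (m : ℝ) * (1 - Λ⁻¹ ^ 2 / 2) ^ (m - 1) :=
    tsum_nonneg fun m => by positivity
  refine ⟨fun i j => ?_, fun i => ?_, fun i => ?_⟩
  · rw [hx]
    exact (hell' x).sum_frameVector hΛ i j
  · exact ((hell' x).sqrt_sum_frameVector_sq_le hΛ i).trans (by linarith)
  · exact (sqrt_sum_frameDeriv_sq_le hΛ (hell' x) (fun k a b => hDle k a b x) i).trans
      (mul_le_mul_of_nonneg_right (by linarith) (Real.sqrt_nonneg _))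

end
end
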